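/- Let T be a subset of {semilattice, majority, affine} and let A1,...,An be similar smooth finite idempotent T-restricted algebras that omit type 1. Then the direct product A1×...×An is T-restricted. -/

import Mathlib

/-! Common framework: universal algebras over a fixed signature, terms,
subalgebras, congruences, quotients, edges and their types (Bulatov's
coloured-graph approach), thin edges, connectivity, products, etc. -/

/-- A (functional) signature: a type of operation symbols with arities. -/
structure Signature where
  ops : Type
  arity : ops → ℕ

/-- An algebra of a given signature. -/
structure UAlgebra (σ : Signature) where
  carrier : Type
  interp : ∀ f : σ.ops, (Fin (σ.arity f) → carrier) → carrier

/-- Terms over the signature `σ` in `n` variables. -/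
inductive Term (σ : Signature) (n : ℕ) where
  | var : Fin n → Term σ n
  | app : (f : σ.ops) → (Fin (σ.arity f) → Term σ n) → Term σ n

/-- Evaluation of a term in an algebra; term operations of an algebra are
exactly the operations of the form `Term.eval A t`. -/
def Term.eval {σ : Signature} {n : ℕ} (A : UAlgebra σ) :
    Term σ n → (Fin n → A.carrier) → A.carrier
  | .var i, x => x i
  | .app f ts, x => A.interp f fun j => Term.eval A (ts j) x

namespace UAlgebra

variable {σ : Signature}

/-- An algebra is idempotent if all its basic operations are. -/
def Idempotent (A : UAlgebra σ) : Prop :=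
  ∀ (f : σ.ops) (a : A.carrier), A.interp f (fun _ => a) = a

/-- A set closed under all basic operations. -/
def IsClosed (A : UAlgebra σ) (S : Set A.carrier) : Prop :=
  ∀ (f : σ.ops) (x : Fin (σ.arity f) → A.carrier), (∀ j, x j ∈ S) → A.interp f x ∈ S

/-- Closure of a set under the basic operations. -/
inductive Closure (A : UAlgebra σ) (S : Set A.carrier) : A.carrier → Prop
  | base {a : A.carrier} : a ∈ S → Closure A S a
  | app (f : σ.ops) (x : Fin (σ.arity f) → A.carrier) :
      (∀ j, Closure A S (x j)) → Closure A S (A.interp f x)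

def ClosureSet (A : UAlgebra σ) (S : Set A.carrier) : Set A.carrier := {x | Closure A S x}

theorem closureSet_isClosed (A : UAlgebra σ) (S : Set A.carrier) :
    A.IsClosed (A.ClosureSet S) := fun f x h => Closure.app f x h

/-- The subalgebra of `A` on a closed subset `S`. -/
def subalg (A : UAlgebra σ) (S : Set A.carrier) (hS : A.IsClosed S) : UAlgebra σ where
  carrier := {x : A.carrier // x ∈ S}
  interp f x := ⟨A.interp f fun j => (x j : A.carrier), hS f _ fun j => (x j).2⟩

/-- The subalgebra generated by a set `S`. -/
def Sg (A : UAlgebra σ) (S : Set A.carrier) : UAlgebra σ :=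
  A.subalg (A.ClosureSet S) (A.closureSet_isClosed S)

/-- `a` as an element of `Sg {a, b}`. -/
def sgA (A : UAlgebra σ) (a b : A.carrier) : (A.Sg {a, b}).carrier :=
  ⟨a, Closure.base (Set.mem_insert a {b})⟩

/-- `b` as an element of `Sg {a, b}`. -/
def sgB (A : UAlgebra σ) (a b : A.carrier) : (A.Sg {a, b}).carrier :=
  ⟨b, Closure.base (Set.mem_insert_iff.mpr (Or.inr rfl))⟩

/-- A congruence of an algebra. -/
structure Congruence (A : UAlgebra σ) where
  rel : A.carrier → A.carrier → Prop
  refl : ∀ x, rel x x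
  symm : ∀ {x y}, rel x y → rel y x
  trans : ∀ {x y z}, rel x y → rel y z → rel x z
  compat : ∀ (f : σ.ops) (x y : Fin (σ.arity f) → A.carrier),
      (∀ j, rel (x j) (y j)) → rel (A.interp f x) (A.interp f y)

def Congruence.toSetoid {A : UAlgebra σ} (θ : Congruence A) : Setoid A.carrier :=
  ⟨θ.rel, ⟨θ.refl, θ.symm, θ.trans⟩⟩

/-- The full congruence. -/
def Congruence.IsFull {A : UAlgebra σ} (θ : Congruence A) : Prop := ∀ x y, θ.rel x y

def Congruence.le {A : UAlgebra σ} (θ η : Congruence A) : Prop :=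
  ∀ x y, θ.rel x y → η.rel x y

/-- A maximal congruence: proper, and any congruence above it is full or below it. -/
def Congruence.IsMaximal {A : UAlgebra σ} (θ : Congruence A) : Prop :=
  ¬ θ.IsFull ∧ ∀ η : Congruence A, θ.le η → ¬ η.IsFull → η.le θ

/-- The quotient (factor) algebra. -/
noncomputable def quot (A : UAlgebra σ) (θ : Congruence A) : UAlgebra σ where
  carrier := Quotient θ.toSetoid
  interp f x := Quotient.mk θ.toSetoid (A.interp f fun j => (x j).out)

/-- The class of `a` in the quotient of `Sg {a,b}` by `θ`. -/
def qa (A : UAlgebra σ) (a b : A.carrier) (θ : Congruence (A.Sg {a, b})) :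
    ((A.Sg {a, b}).quot θ).carrier :=
  Quotient.mk θ.toSetoid (A.sgA a b)

def qb (A : UAlgebra σ) (a b : A.carrier) (θ : Congruence (A.Sg {a, b})) :
    ((A.Sg {a, b}).quot θ).carrier :=
  Quotient.mk θ.toSetoid (A.sgB a b)

end UAlgebra

/-- A binary operation is a semilattice operation on a set `B`. -/
def IsSemilatticeOn {α : Type} (f : α → α → α) (B : Set α) : Prop :=
  (∀ x ∈ B, f x x = x) ∧ (∀ x ∈ B, ∀ y ∈ B, f x y = f y x) ∧
    (∀ x ∈ B, ∀ y ∈ B, ∀ z ∈ B, f x (f y z) = f (f x y) z)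

/-- A ternary operation is a majority operation on a set `B`. -/
def IsMajorityOn {α : Type} (g : α → α → α → α) (B : Set α) : Prop :=
  ∀ x ∈ B, ∀ y ∈ B, g x x y = x ∧ g x y x = x ∧ g y x x = x

/-- A ternary operation is a Mal'tsev operation on a set `B`. -/
def IsMaltsevOn {α : Type} (h : α → α → α → α) (B : Set α) : Prop :=
  ∀ x ∈ B, ∀ y ∈ B, h x y y = x ∧ h y y x = x

namespace UAlgebra

variable {σ : Signature}

/-- An algebra is "a set": every term operation is a projection. -/
def IsSetAlgebra (Q : UAlgebra σ) : Prop :=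
  ∀ (n : ℕ) (t : Term σ n), ∃ i : Fin n, ∀ x : Fin n → Q.carrier, t.eval Q x = x i

/-- An algebra is the full idempotent reduct of a module over some finite ring:
its term operations are exactly the idempotent affine combinations; in
particular the affine operation `x - y + z` is a term operation. -/
def IsAffineAlgebra (Q : UAlgebra σ) : Prop :=
  ∃ (R : Type) (_ : Ring R) (_ : Finite R) (_ : AddCommGroup Q.carrier)
    (_ : Module R Q.carrier),
    (∀ (n : ℕ) (g : (Fin n → Q.carrier) → Q.carrier),
      (∃ t : Term σ n, ∀ x, t.eval Q x = g x) ↔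
      (∃ c : Fin n → R, (∑ i, c i) = 1 ∧ ∀ x, g x = ∑ i, c i • x i)) ∧
    (∃ t : Term σ 3, ∀ x y z : Q.carrier, t.eval Q ![x, y, z] = x - y + z)

/-- `θ` witnesses that `ab` is an edge of the unary type. -/
def UnaryWitness (A : UAlgebra σ) (a b : A.carrier) (θ : Congruence (A.Sg {a, b})) : Prop :=
  θ.IsMaximal ∧ IsSetAlgebra ((A.Sg {a, b}).quot θ)

/-- `θ` witnesses that `ab` is an edge of the semilattice type. -/
def SLWitness (A : UAlgebra σ) (a b : A.carrier) (θ : Congruence (A.Sg {a, b})) : Prop :=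
  θ.IsMaximal ∧ ∃ t : Term σ 2,
    IsSemilatticeOn (fun x y => t.eval ((A.Sg {a, b}).quot θ) ![x, y])
      {A.qa a b θ, A.qb a b θ}

/-- `θ` witnesses that `ab` is an edge of the majority type. -/
def MajWitness (A : UAlgebra σ) (a b : A.carrier) (θ : Congruence (A.Sg {a, b})) : Prop :=
  θ.IsMaximal ∧
  (∃ t : Term σ 3,
    IsMajorityOn (fun x y z => t.eval ((A.Sg {a, b}).quot θ) ![x, y, z])
      {A.qa a b θ, A.qb a b θ}) ∧
  ¬ (∃ t : Term σ 2,
    IsSemilatticeOn (fun x y => t.eval ((A.Sg {a, b}).quot θ) ![x, y])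
      {A.qa a b θ, A.qb a b θ})

/-- `θ` witnesses that `ab` is an edge of the affine type. -/
def AffWitness (A : UAlgebra σ) (a b : A.carrier) (θ : Congruence (A.Sg {a, b})) : Prop :=
  θ.IsMaximal ∧ IsAffineAlgebra ((A.Sg {a, b}).quot θ)

/-- A pair of distinct elements is an edge. -/
def IsEdge (A : UAlgebra σ) (a b : A.carrier) : Prop :=
  a ≠ b ∧ ∃ θ : Congruence (A.Sg {a, b}), ¬ θ.IsFull ∧
    (IsSetAlgebra ((A.Sg {a, b}).quot θ) ∨
     IsAffineAlgebra ((A.Sg {a, b}).quot θ) ∨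
     (∃ t : Term σ 2,
        IsSemilatticeOn (fun x y => t.eval ((A.Sg {a, b}).quot θ) ![x, y])
          {A.qa a b θ, A.qb a b θ}) ∨
     (∃ t : Term σ 3,
        IsMajorityOn (fun x y z => t.eval ((A.Sg {a, b}).quot θ) ![x, y, z])
          {A.qa a b θ, A.qb a b θ}))

def IsUnaryEdge (A : UAlgebra σ) (a b : A.carrier) : Prop :=
  a ≠ b ∧ ∃ θ : Congruence (A.Sg {a, b}), UnaryWitness A a b θ

def IsSLEdge (A : UAlgebra σ) (a b : A.carrier) : Prop :=
  a ≠ b ∧ ∃ θ : Congruence (A.Sg {a, b}), SLWitness A a b θ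

def IsMajEdge (A : UAlgebra σ) (a b : A.carrier) : Prop :=
  a ≠ b ∧ ∃ θ : Congruence (A.Sg {a, b}), MajWitness A a b θ

def IsAffEdge (A : UAlgebra σ) (a b : A.carrier) : Prop :=
  a ≠ b ∧ ∃ θ : Congruence (A.Sg {a, b}), AffWitness A a b θ

end UAlgebra

/-- The four types of edges. -/
inductive EdgeType where
  | unary | semilattice | majority | affine
deriving DecidableEq

namespace UAlgebra

variable {σ : Signature}

def HasEdgeOfType (A : UAlgebra σ) (τ : EdgeType) (a b : A.carrier) : Prop :=
  match τ with
  | .unary => A.IsUnaryEdge a b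
  | .semilattice => A.IsSLEdge a b
  | .majority => A.IsMajEdge a b
  | .affine => A.IsAffEdge a b

/-- `T`-restricted algebra: every edge has a type from `T`. -/
def Restricted (A : UAlgebra σ) (T : Set EdgeType) : Prop :=
  ∀ a b : A.carrier, A.IsEdge a b → ∃ τ ∈ T, A.HasEdgeOfType τ a b

/-- `A` omits type 1: no subalgebra of `A` has an edge of the unary type. -/
def OmitsType1 (A : UAlgebra σ) : Prop :=
  ∀ (S : Set A.carrier) (hS : A.IsClosed S) (a b : (A.subalg S hS).carrier),
    ¬ (A.subalg S hS).IsUnaryEdge a b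

/-- The union of the two `θ`-blocks of a thick edge, as a subset of `A`. -/
def edgeBlockUnion (A : UAlgebra σ) (a b : A.carrier) (θ : Congruence (A.Sg {a, b})) :
    Set A.carrier :=
  {x | ∃ hx : x ∈ A.ClosureSet {a, b},
    θ.rel ⟨x, hx⟩ (A.sgA a b) ∨ θ.rel ⟨x, hx⟩ (A.sgB a b)}

/-- Smooth algebra: for every semilattice- or majority-type edge with a witnessing
maximal congruence, the union of the two blocks is a subuniverse. -/
def IsSmooth (A : UAlgebra σ) : Prop :=
  ∀ (a b : A.carrier) (θ : Congruence (A.Sg {a, b})),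
    (SLWitness A a b θ ∨ MajWitness A a b θ) → A.IsClosed (A.edgeBlockUnion a b θ)

def SemilatticeFree (A : UAlgebra σ) : Prop := ∀ a b : A.carrier, ¬ A.IsSLEdge a b
def MajorityFree (A : UAlgebra σ) : Prop := ∀ a b : A.carrier, ¬ A.IsMajEdge a b
def AffineFree (A : UAlgebra σ) : Prop := ∀ a b : A.carrier, ¬ A.IsAffEdge a b

/-- Thin semilattice edge. -/
def IsThinSLEdge (A : UAlgebra σ) (a b : A.carrier) : Prop :=
  ∃ t : Term σ 2, t.eval A ![a, a] = a ∧ t.eval A ![a, b] = b ∧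
    t.eval A ![b, a] = b ∧ t.eval A ![b, b] = b

/-- Undirected thin majority edge: some term operation is majority on `{a, b}`. -/
def IsUndirThinMajEdge (A : UAlgebra σ) (a b : A.carrier) : Prop :=
  ∃ t : Term σ 3, IsMajorityOn (fun x y z => t.eval A ![x, y, z]) {a, b}

/-- Mal'tsev edge: some term operation is Mal'tsev on `{a, b}`. -/
def IsMaltsevEdge (A : UAlgebra σ) (a b : A.carrier) : Prop :=
  ∃ t : Term σ 3, IsMaltsevOn (fun x y z => t.eval A ![x, y, z]) {a, b}

/-- The class of all quotients of subalgebras of `A`. -/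
def QuotSub (A : UAlgebra σ) : Set (UAlgebra σ) :=
  {B | ∃ (S : Set A.carrier) (hS : A.IsClosed S)
        (θ : Congruence (A.subalg S hS)), B = (A.subalg S hS).quot θ}

end UAlgebra

/-- The class of all quotients of subalgebras of the algebras of a class. -/
def QuotSubClass {σ : Signature} (K : Set (UAlgebra σ)) : Set (UAlgebra σ) :=
  {B | ∃ A ∈ K, B ∈ UAlgebra.QuotSub A}

/-- A ternary term satisfies the majority condition relative to a class `𝒦`. -/
def MajorityCondition {σ : Signature} (𝒦 : Set (UAlgebra σ)) (t : Term σ 3) : Prop :=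
  (∀ B ∈ 𝒦, ∀ x y : B.carrier,
    t.eval B ![x, t.eval B ![x, y, y], t.eval B ![x, y, y]] = t.eval B ![x, y, y]) ∧
  (∀ B ∈ 𝒦, ∀ (a b : B.carrier) (θ : UAlgebra.Congruence (B.Sg {a, b})),
    a ≠ b → UAlgebra.MajWitness B a b θ →
    IsMajorityOn (fun x y z => t.eval ((B.Sg {a, b}).quot θ) ![x, y, z])
      {B.qa a b θ, B.qb a b θ})

/-- A ternary term satisfies the minority condition relative to a class `𝒦`. -/
def MinorityCondition {σ : Signature} (𝒦 : Set (UAlgebra σ)) (t : Term σ 3) : Prop :=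
  (∀ B ∈ 𝒦, ∀ x y : B.carrier,
    t.eval B ![t.eval B ![x, y, y], y, y] = t.eval B ![x, y, y]) ∧
  (∀ B ∈ 𝒦, ∀ (a b : B.carrier) (θ : UAlgebra.Congruence (B.Sg {a, b})),
    a ≠ b → UAlgebra.AffWitness B a b θ →
    IsMaltsevOn (fun x y z => t.eval ((B.Sg {a, b}).quot θ) ![x, y, z])
      {B.qa a b θ, B.qb a b θ})

/-- Thin majority edge relative to a class `𝒦`. -/
def IsThinMajEdge {σ : Signature} (𝒦 : Set (UAlgebra σ)) (A : UAlgebra σ)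
    (a b : A.carrier) : Prop :=
  ∀ t : Term σ 3, MajorityCondition 𝒦 t →
    b ∈ A.ClosureSet {a, t.eval A ![a, b, b]} ∧
    b ∈ A.ClosureSet {a, t.eval A ![b, a, b]} ∧
    b ∈ A.ClosureSet {a, t.eval A ![b, b, a]}

/-- Thin affine edge relative to a class `𝒦` (with respect to some fixed term
operation satisfying the minority condition). -/
def IsThinAffEdge {σ : Signature} (𝒦 : Set (UAlgebra σ)) (A : UAlgebra σ)
    (a b : A.carrier) : Prop :=
  (∃ t : Term σ 3, MinorityCondition 𝒦 t ∧ t.eval A ![b, a, a] = b) ∧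
  ∀ t : Term σ 3, MinorityCondition 𝒦 t → b ∈ A.ClosureSet {a, t.eval A ![a, a, b]}

namespace UAlgebra

variable {σ : Signature}

/-- Reachability in the digraph `Gs(A)` of thin semilattice edges. -/
def sReach (A : UAlgebra σ) : A.carrier → A.carrier → Prop :=
  Relation.ReflTransGen (fun x y => A.IsThinSLEdge x y)

/-- A maximal element of `Gs(A)`: an element of a maximal strongly connected
component. -/
def IsMaxElem (A : UAlgebra σ) (a : A.carrier) : Prop :=
  ∀ b, A.sReach a b → A.sReach b a

/-- A maximal component of `Gs(A)`: the strongly connected component of a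
maximal element. -/
def IsMaxComponent (A : UAlgebra σ) (C : Set A.carrier) : Prop :=
  ∃ a, A.IsMaxElem a ∧ C = {b | A.sReach a b ∧ A.sReach b a}

end UAlgebra

/-- An arc of the digraph `Gas(A)`: a thin semilattice or thin affine edge. -/
def asStep {σ : Signature} (𝒦 : Set (UAlgebra σ)) (A : UAlgebra σ)
    (x y : A.carrier) : Prop :=
  A.IsThinSLEdge x y ∨ IsThinAffEdge 𝒦 A x y

/-- Reachability in `Gas(A)`. -/
def asReach {σ : Signature} (𝒦 : Set (UAlgebra σ)) (A : UAlgebra σ) :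
    A.carrier → A.carrier → Prop :=
  Relation.ReflTransGen (asStep 𝒦 A)

/-- An as-maximal element: an element of an as-component. -/
def IsAsMaxElem {σ : Signature} (𝒦 : Set (UAlgebra σ)) (A : UAlgebra σ)
    (a : A.carrier) : Prop :=
  ∀ b, asReach 𝒦 A a b → asReach 𝒦 A b a

/-- An as-component of `A`: a maximal strongly connected component of `Gas(A)`. -/
def IsAsComponent {σ : Signature} (𝒦 : Set (UAlgebra σ)) (A : UAlgebra σ)
    (C : Set A.carrier) : Prop :=
  ∃ a, IsAsMaxElem 𝒦 A a ∧ C = {b | asReach 𝒦 A a b ∧ asReach 𝒦 A b a}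

namespace UAlgebra

variable {σ : Signature}

/-- Binary direct product. -/
def prod (A B : UAlgebra σ) : UAlgebra σ where
  carrier := A.carrier × B.carrier
  interp f x := (A.interp f fun j => (x j).1, B.interp f fun j => (x j).2)

/-- Direct product of a family. -/
def pi {ι : Type} (A : ι → UAlgebra σ) : UAlgebra σ where
  carrier := ∀ i, (A i).carrier
  interp f x := fun i => (A i).interp f fun j => x j i

/-- Homomorphism of similar algebras. -/
def IsHom (A B : UAlgebra σ) (φ : A.carrier → B.carrier) : Prop :=
  ∀ (f : σ.ops) (x : Fin (σ.arity f) → A.carrier),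
    φ (A.interp f x) = B.interp f fun j => φ (x j)

/-- Simple algebra: only the equality and full congruences. -/
def IsSimple (A : UAlgebra σ) : Prop :=
  ∀ θ : Congruence A, (∀ x y, θ.rel x y ↔ x = y) ∨ θ.IsFull

/-- Maximal generated algebra: generated by one of its maximal components. -/
def MaximalGenerated (A : UAlgebra σ) : Prop :=
  ∃ C : Set A.carrier, A.IsMaxComponent C ∧ A.ClosureSet C = Set.univ

/-- The number of subalgebras (nonempty closed subsets) of an algebra. -/
noncomputable def numSubalgebras (A : UAlgebra σ) : ℕ :=
  Nat.card {S : Set A.carrier // S.Nonempty ∧ A.IsClosed S}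

end UAlgebra

/-- A (k+3)-ary term is an edge term for a class `𝒦`. -/
def IsEdgeTermFor {σ : Signature} (𝒦 : Set (UAlgebra σ)) {k : ℕ}
    (t : Term σ (k + 3)) : Prop :=
  ∀ A ∈ 𝒦, ∀ x y : A.carrier,
    t.eval A (fun i => if i.val ≤ 1 then y else x) = x ∧
    t.eval A (fun i => if i.val = 0 ∨ i.val = 2 then y else x) = x ∧
    ∀ j : Fin (k + 3), 3 ≤ j.val →
      t.eval A (Function.update (fun _ => x) j y) = x

/-- A finite class has few subproducts. -/
def FewSubproducts {σ : Signature} (K : Set (UAlgebra σ)) : Prop :=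
  ∃ p : Polynomial ℕ, ∀ (n : ℕ) (A : Fin n → UAlgebra σ), (∀ i, A i ∈ K) →
    UAlgebra.numSubalgebras (UAlgebra.pi A) ≤ 2 ^ (p.eval n)

/-- `g_K` is bounded by a polynomial: every subalgebra of an `n`-fold product
of members of `K` has a generating set of polynomial size. -/
def PolyGenerated {σ : Signature} (K : Set (UAlgebra σ)) : Prop :=
  ∃ p : Polynomial ℕ, ∀ (n : ℕ) (A : Fin n → UAlgebra σ), (∀ i, A i ∈ K) →
    ∀ S : Set (UAlgebra.pi A).carrier, S.Nonempty → (UAlgebra.pi A).IsClosed S →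
      ∃ G : Set (UAlgebra.pi A).carrier, G ⊆ S ∧ G.Finite ∧
        G.ncard ≤ p.eval n ∧ (UAlgebra.pi A).ClosureSet G = S

namespace Term

variable {σ : Signature} {n m : ℕ}

/-- Simultaneous substitution of terms for variables. -/
def subst : Term σ n → (Fin n → Term σ m) → Term σ m
  | .var i, s => s i
  | .app f ts, s => .app f fun j => (ts j).subst s

theorem eval_subst (A : UAlgebra σ) (t : Term σ n) (s : Fin n → Term σ m)
    (x : Fin m → A.carrier) :
    (t.subst s).eval A x = t.eval A fun i => (s i).eval A x := by
  induction t with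
  | var i => rfl
  | app f ts ih => exact congrArg (A.interp f) (funext fun j => ih j)

/-- Substitution into a binary term. -/
def subst₂ (t : Term σ 2) (p q : Term σ m) : Term σ m := t.subst ![p, q]

theorem eval_subst₂ (A : UAlgebra σ) (t : Term σ 2) (p q : Term σ m)
    (x : Fin m → A.carrier) :
    (t.subst₂ p q).eval A x = t.eval A ![p.eval A x, q.eval A x] := by
  rw [subst₂, eval_subst]
  congr 1
  funext i
  fin_cases i <;> rfl

end Term

namespace UAlgebra

variable {σ : Signature} {A B Q Q' : UAlgebra σ}

theorem IsHom.map_eval {φ : A.carrier → B.carrier} (h : IsHom A B φ) {n : ℕ} (t : Term σ n)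
    (x : Fin n → A.carrier) : φ (t.eval A x) = t.eval B fun i => φ (x i) := by
  induction t with
  | var i => rfl
  | app f ts ih => exact (h f _).trans (congrArg (B.interp f) (funext fun j => ih j))

theorem IsHom.map_eval₂ {φ : A.carrier → B.carrier} (h : IsHom A B φ) (t : Term σ 2)
    (x y : A.carrier) : φ (t.eval A ![x, y]) = t.eval B ![φ x, φ y] := by
  rw [h.map_eval]
  congr 1
  funext i
  fin_cases i <;> rfl

theorem IsHom.map_eval₃ {φ : A.carrier → B.carrier} (h : IsHom A B φ) (t : Term σ 3)
    (x y z : A.carrier) : φ (t.eval A ![x, y, z]) = t.eval B ![φ x, φ y, φ z] := by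
  rw [h.map_eval]
  congr 1
  funext i
  fin_cases i <;> rfl

theorem IsHom.comp {C : UAlgebra σ} {φ : A.carrier → B.carrier} {ψ : B.carrier → C.carrier}
    (hψ : IsHom B C ψ) (hφ : IsHom A B φ) : IsHom A C fun a => ψ (φ a) := fun f x =>
  (congrArg ψ (hφ f x)).trans (hψ f _)

theorem Idempotent.eval_const (h : A.Idempotent) {n : ℕ} (t : Term σ n) (a : A.carrier) :
    t.eval A (fun _ => a) = a := by
  induction t with
  | var i => rfl
  | app f ts ih =>
    change A.interp f (fun j => (ts j).eval A fun _ => a) = a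
    simp only [ih]
    exact h f a

theorem Idempotent.eval_pair (h : A.Idempotent) (t : Term σ 2) (a : A.carrier) :
    t.eval A ![a, a] = a := by
  have : (![a, a] : Fin 2 → A.carrier) = fun _ => a := by
    funext i
    fin_cases i <;> rfl
  rw [this, h.eval_const]

theorem Idempotent.of_surjective {φ : A.carrier → B.carrier} (h : A.Idempotent)
    (hφ : IsHom A B φ) (hs : Function.Surjective φ) : B.Idempotent := fun f b => by
  obtain ⟨a, rfl⟩ := hs b
  rw [← hφ f fun _ => a, h f a]

theorem Idempotent.subalg (h : A.Idempotent) (S : Set A.carrier) (hS : A.IsClosed S) :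
    (A.subalg S hS).Idempotent := fun f a => Subtype.ext (h f a.1)

theorem Idempotent.pi {ι : Type} {A : ι → UAlgebra σ} (h : ∀ i, (A i).Idempotent) :
    (UAlgebra.pi A).Idempotent := fun f a => funext fun i => h i f (a i)

theorem isHom_val (S : Set A.carrier) (hS : A.IsClosed S) :
    IsHom (A.subalg S hS) A Subtype.val := fun _ _ => rfl

theorem IsClosed.eval_mem {S : Set A.carrier} (hS : A.IsClosed S) {n : ℕ} (t : Term σ n)
    (x : Fin n → A.carrier) (hx : ∀ i, x i ∈ S) : t.eval A x ∈ S := by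
  induction t with
  | var i => exact hx i
  | app f ts ih => exact hS f _ ih

theorem closureSet_subset {G S : Set A.carrier} (hS : A.IsClosed S) (h : G ⊆ S) :
    A.ClosureSet G ⊆ S := fun x hx => by
  induction hx with
  | base ha => exact h ha
  | app f x _ ih => exact hS f x ih

theorem subset_closureSet (A : UAlgebra σ) (G : Set A.carrier) : G ⊆ A.ClosureSet G :=
  fun _ h => .base h

theorem exists_term_of_mem_closure {a b r : A.carrier} (h : r ∈ A.ClosureSet {a, b}) :
    ∃ t : Term σ 2, t.eval A ![a, b] = r := by
  induction h with
  | base ha =>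
    rcases ha with rfl | rfl
    · exact ⟨.var 0, rfl⟩
    · exact ⟨.var 1, rfl⟩
  | app f x _ ih =>
    choose t ht using ih
    exact ⟨.app f t, congrArg (A.interp f) (funext ht)⟩

theorem closureSet_sg (A : UAlgebra σ) (a b : A.carrier) :
    (A.Sg {a, b}).ClosureSet {A.sgA a b, A.sgB a b} = Set.univ := by
  refine Set.eq_univ_of_forall fun r => ?_
  obtain ⟨t, ht⟩ := exists_term_of_mem_closure r.2
  have : r = t.eval (A.Sg {a, b}) ![A.sgA a b, A.sgB a b] := by
    apply Subtype.ext
    rw [← ht]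
    exact ((isHom_val _ (A.closureSet_isClosed {a, b})).map_eval₂ t (A.sgA a b) (A.sgB a b)).symm
  rw [this]
  refine (closureSet_isClosed _ _).eval_mem t _ fun i => ?_
  fin_cases i
  · exact .base (Or.inl rfl)
  · exact .base (Or.inr rfl)

/-- The congruence `φ r = φ s`. -/
def IsHom.ker {φ : A.carrier → B.carrier} (h : IsHom A B φ) : Congruence A where
  rel r s := φ r = φ s
  refl _ := rfl
  symm h := h.symm
  trans h h' := h.trans h'
  compat f x y hxy := by rw [h f x, h f y, funext hxy]

theorem Congruence.mk_eq_mk (θ : Congruence A) {x y : A.carrier} :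
    Quotient.mk θ.toSetoid x = Quotient.mk θ.toSetoid y ↔ θ.rel x y := Quotient.eq

theorem Congruence.isHom_mk (θ : Congruence A) :
    IsHom A (A.quot θ) (Quotient.mk θ.toSetoid) := fun f x =>
  θ.mk_eq_mk.2 <| θ.compat f _ _ fun j =>
    θ.mk_eq_mk.1 (Quotient.out_eq (Quotient.mk θ.toSetoid (x j))).symm

theorem Congruence.isClosed_class (h : A.Idempotent) (θ : Congruence A) (a : A.carrier) :
    A.IsClosed {x | θ.rel x a} := fun f x hx => by
  have := θ.compat f x (fun _ => a) hx
  rwa [h f a] at this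

/-- A homomorphism onto `Q'` factors through any surjective one with a smaller kernel. -/
theorem exists_isHom_factor {φ : A.carrier → Q.carrier} {ψ : A.carrier → Q'.carrier}
    (hφ : IsHom A Q φ) (hψ : IsHom A Q' ψ) (sφ : Function.Surjective φ)
    (sψ : Function.Surjective ψ) (h : ∀ r s, φ r = φ s → ψ r = ψ s) :
    ∃ χ : Q.carrier → Q'.carrier, IsHom Q Q' χ ∧ Function.Surjective χ ∧
      ∀ r, χ (φ r) = ψ r := by
  have key : ∀ r, ψ (Function.surjInv sφ (φ r)) = ψ r := fun r =>
    h _ _ (Function.surjInv_eq sφ (φ r))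
  refine ⟨fun q => ψ (Function.surjInv sφ q), fun f x => ?_, fun q => ?_, key⟩
  · have : Q.interp f x = φ (A.interp f fun j => Function.surjInv sφ (x j)) := by
      rw [hφ f]
      simp only [Function.surjInv_eq]
    rw [this]
    exact (key _).trans (hψ f _)
  · obtain ⟨r, rfl⟩ := sψ q
    exact ⟨φ r, key r⟩

theorem IsSimple.isFull (h : Q.IsSimple) (η : Congruence Q) {x y : Q.carrier} (hne : x ≠ y)
    (hxy : η.rel x y) : η.IsFull :=
  (h η).resolve_left fun h' => hne ((h' x y).1 hxy)

/-- The preimage of a congruence under a homomorphism. -/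
def Congruence.comap {φ : A.carrier → B.carrier} (h : IsHom A B φ) (η : Congruence B) :
    Congruence A where
  rel r s := η.rel (φ r) (φ s)
  refl _ := η.refl _
  symm h := η.symm h
  trans h h' := η.trans h h'
  compat f x y hxy := by
    rw [h f x, h f y]
    exact η.compat f _ _ hxy

theorem IsHom.isMaximal_iff {φ : A.carrier → Q.carrier} (hφ : IsHom A Q φ)
    (hs : Function.Surjective φ) (θ : Congruence A) (hθ : ∀ r s, θ.rel r s ↔ φ r = φ s) :
    θ.IsMaximal ↔ Q.IsSimple ∧ ∃ x y : Q.carrier, x ≠ y := by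
  constructor
  · rintro ⟨h1, h2⟩
    refine ⟨fun η => ?_, ?_⟩
    · by_cases hf : (η.comap hφ).IsFull
      · refine Or.inr fun x y => ?_
        obtain ⟨r, rfl⟩ := hs x
        obtain ⟨s, rfl⟩ := hs y
        exact hf r s
      · have := h2 (η.comap hφ) (fun r s h => by
          change η.rel (φ r) (φ s)
          rw [(hθ r s).1 h]
          exact η.refl _) hf
        refine Or.inl fun x y => ⟨fun h => ?_, fun h => h ▸ η.refl _⟩
        obtain ⟨r, rfl⟩ := hs x
        obtain ⟨s, rfl⟩ := hs y
        exact (hθ r s).1 (this r s h)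
    · by_contra! hne
      exact h1 fun r s => (hθ r s).2 (hne _ _)
  · rintro ⟨h1, x, y, hxy⟩
    refine ⟨fun hf => ?_, fun η hle hη r s hrs => ?_⟩
    · obtain ⟨r, rfl⟩ := hs x
      obtain ⟨s, rfl⟩ := hs y
      exact hxy ((hθ r s).1 (hf r s))
    · by_contra hne
      rw [hθ] at hne
      apply hη
      have lift : ∀ {a b c d}, φ a = φ c → φ b = φ d → (η.rel a b → η.rel c d) := fun h h' hr =>
        η.trans (η.symm (hle _ _ ((hθ _ _).2 h))) (η.trans hr (hle _ _ ((hθ _ _).2 h')))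
      let ζ : Congruence Q :=
        { rel := fun a b => η.rel (Function.surjInv hs a) (Function.surjInv hs b)
          refl := fun _ => η.refl _
          symm := fun h => η.symm h
          trans := fun h h' => η.trans h h'
          compat := fun f a b hab => by
            refine lift ?_ ?_ (η.compat f _ _ hab)
            · rw [hφ f]
              simp only [Function.surjInv_eq]
            · rw [hφ f]
              simp only [Function.surjInv_eq] }
      have := h1.isFull ζ hne (lift (Function.surjInv_eq hs _).symm
        (Function.surjInv_eq hs _).symm hrs)
      exact fun a b => lift (Function.surjInv_eq hs _) (Function.surjInv_eq hs _)
        (this (φ a) (φ b))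

theorem Congruence.IsMaximal.isSimple_quot {θ : Congruence A} (h : θ.IsMaximal) :
    (A.quot θ).IsSimple :=
  ((θ.isHom_mk.isMaximal_iff Quotient.mk_surjective θ fun _ _ => θ.mk_eq_mk.symm).1 h).1

theorem Congruence.exists_isMaximal [Finite A.carrier] (θ : Congruence A) (h : ¬ θ.IsFull) :
    ∃ η : Congruence A, θ.le η ∧ η.IsMaximal := by
  let g : Congruence A → ℕ := fun η => {p : A.carrier × A.carrier | ¬ η.rel p.1 p.2}.ncard
  obtain ⟨η, ⟨hle, hη⟩, hmin⟩ := (measure g).wf.has_min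
    {η | θ.le η ∧ ¬ η.IsFull} ⟨θ, fun _ _ h => h, h⟩
  refine ⟨η, hle, hη, fun ζ hζ hf r s hrs => ?_⟩
  by_contra hne
  refine hmin ζ ⟨fun x y hxy => hζ x y (hle x y hxy), hf⟩ ?_
  refine Set.ncard_lt_ncard ⟨fun p hp hp' => hp (hζ _ _ hp'), fun hsub => ?_⟩ (Set.toFinite _)
  exact hsub (show (r, s) ∈ {p : A.carrier × A.carrier | ¬ η.rel p.1 p.2} from hne) hrs

/-- Some binary term operation is a semilattice operation on `{x, y}`. -/
def HasSemilattice (Q : UAlgebra σ) (x y : Q.carrier) : Prop :=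
  ∃ t : Term σ 2, IsSemilatticeOn (fun a b => t.eval Q ![a, b]) {x, y}

/-- Some ternary term operation is a majority operation on `{x, y}`. -/
def HasMajority (Q : UAlgebra σ) (x y : Q.carrier) : Prop :=
  ∃ t : Term σ 3, IsMajorityOn (fun a b c => t.eval Q ![a, b, c]) {x, y}

theorem HasSemilattice.map {χ : Q.carrier → Q'.carrier} (hχ : IsHom Q Q' χ) {x y : Q.carrier}
    (h : Q.HasSemilattice x y) : Q'.HasSemilattice (χ x) (χ y) := by
  obtain ⟨t, h1, h2, h3⟩ := h
  refine ⟨t, ?_⟩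
  rw [← Set.image_pair]
  refine ⟨?_, ?_, ?_⟩
  · rintro _ ⟨a, ha, rfl⟩
    simp only [← hχ.map_eval₂]
    exact congrArg χ (h1 a ha)
  · rintro _ ⟨a, ha, rfl⟩ _ ⟨b, hb, rfl⟩
    simp only [← hχ.map_eval₂]
    exact congrArg χ (h2 a ha b hb)
  · rintro _ ⟨a, ha, rfl⟩ _ ⟨b, hb, rfl⟩ _ ⟨c, hc, rfl⟩
    simp only [← hχ.map_eval₂]
    exact congrArg χ (h3 a ha b hb c hc)

theorem HasMajority.map {χ : Q.carrier → Q'.carrier} (hχ : IsHom Q Q' χ) {x y : Q.carrier}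
    (h : Q.HasMajority x y) : Q'.HasMajority (χ x) (χ y) := by
  obtain ⟨t, h1⟩ := h
  refine ⟨t, ?_⟩
  rw [← Set.image_pair]
  rintro _ ⟨a, ha, rfl⟩ _ ⟨b, hb, rfl⟩
  simp only [← hχ.map_eval₃]
  obtain ⟨h2, h3, h4⟩ := h1 a ha b hb
  exact ⟨congrArg χ h2, congrArg χ h3, congrArg χ h4⟩

theorem IsSetAlgebra.map {χ : Q.carrier → Q'.carrier} (hχ : IsHom Q Q' χ)
    (hs : Function.Surjective χ) (h : Q.IsSetAlgebra) : Q'.IsSetAlgebra := fun n t => by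
  obtain ⟨i, hi⟩ := h n t
  refine ⟨i, fun x => ?_⟩
  obtain ⟨y, rfl⟩ := hs.comp_left x
  have := hχ.map_eval t y
  rw [hi y] at this
  exact this.symm

end UAlgebra

namespace UAlgebra

variable {σ : Signature} {A B Q Q' : UAlgebra σ}

theorem hasSemilattice_iff {x y : Q.carrier} (hQ : Q.Idempotent) :
    Q.HasSemilattice x y ↔ ∃ (t : Term σ 2) (u : Q.carrier),
      t.eval Q ![x, y] = u ∧ t.eval Q ![y, x] = u ∧ t.eval Q ![x, u] = u ∧
      t.eval Q ![u, x] = u ∧ t.eval Q ![y, u] = u ∧ t.eval Q ![u, y] = u := by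
  have hi : ∀ (t : Term σ 2) a, t.eval Q ![a, a] = a := hQ.eval_pair
  constructor
  · rintro ⟨t, -, h2, h3⟩
    simp only [Set.mem_insert_iff, Set.mem_singleton_iff, forall_eq_or_imp, forall_eq, hi]
      at h2 h3
    obtain ⟨⟨-, h2⟩, -⟩ := h2
    refine ⟨t, _, rfl, h2.symm, ?_⟩
    grind
  · rintro ⟨t, u, h1, h2, h3, h4, h5, h6⟩
    refine ⟨t, ?_, ?_, ?_⟩ <;>
      simp only [Set.mem_insert_iff, Set.mem_singleton_iff, forall_eq_or_imp, forall_eq, hi, h1,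
        h2, h3, h4, h5, h6, and_self]

theorem HasMajority.exists_eq {x y : Q.carrier} (h : Q.HasMajority x y) :
    ∃ t : Term σ 3, t.eval Q ![x, x, y] = x ∧ t.eval Q ![x, y, x] = x ∧
      t.eval Q ![y, x, x] = x ∧ t.eval Q ![y, y, x] = y ∧ t.eval Q ![y, x, y] = y ∧
      t.eval Q ![x, y, y] = y := by
  obtain ⟨t, ht⟩ := h
  obtain ⟨h1, h2, h3⟩ := ht x (Or.inl rfl) y (Or.inr rfl)
  obtain ⟨h4, h5, h6⟩ := ht y (Or.inr rfl) x (Or.inl rfl)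
  exact ⟨t, h1, h2, h3, h4, h5, h6⟩

theorem HasSemilattice.symm {x y : Q.carrier} (h : Q.HasSemilattice x y) :
    Q.HasSemilattice y x := by
  rwa [HasSemilattice, Set.pair_comm]

theorem HasMajority.symm {x y : Q.carrier} (h : Q.HasMajority x y) : Q.HasMajority y x := by
  rwa [HasMajority, Set.pair_comm]

/-- Every closed subset with at least two elements is everything. -/
def IsStrictlySimple (Q : UAlgebra σ) : Prop :=
  ∀ S : Set Q.carrier, Q.IsClosed S → ∀ x ∈ S, ∀ y ∈ S, x ≠ y → S = Set.univ

theorem IsAffineAlgebra.map {χ : Q.carrier → Q'.carrier} (hχ : IsHom Q Q' χ)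
    (hs : Function.Surjective χ) (h : Q.IsAffineAlgebra) : Q'.IsAffineAlgebra := by
  obtain ⟨R, _, _, _, _, h, m, hm⟩ := h
  have hadd : ∀ a b k, χ a = χ b → χ (a + k) = χ (b + k) := fun a b k hab => by
    have e := hχ.map_eval₃ m a 0 k
    have e' := hχ.map_eval₃ m b 0 k
    rw [hm, sub_zero] at e e'
    rw [e, e', hab]
  let N : Submodule R Q.carrier :=
    { carrier := {a | χ a = χ 0}
      zero_mem' := rfl
      add_mem' := fun {a b} ha hb => by
        change χ (a + b) = χ 0
        rw [hadd a 0 b ha, zero_add]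
        exact hb
      smul_mem' := fun r a ha => by
        obtain ⟨t, ht⟩ := (h 2 fun x => ∑ i, ![r, 1 - r] i • x i).2
          ⟨![r, 1 - r], by simp, fun _ => rfl⟩
        have e := hχ.map_eval₂ t a 0
        have e' := hχ.map_eval₂ t 0 0
        rw [ht] at e e'
        simp only [Fin.sum_univ_two, Matrix.cons_val_zero, Matrix.cons_val_one, smul_zero,
          add_zero] at e e'
        change χ (r • a) = χ 0
        exact e.trans ((congrArg (fun z => t.eval Q' ![z, χ 0]) ha).trans e'.symm) }
  have hN : ∀ a b, χ a = χ b ↔ a - b ∈ N := fun a b => by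
    constructor
    · intro hab
      change χ (a - b) = χ 0
      have := hadd a b (-b) hab
      rwa [← sub_eq_add_neg, add_neg_cancel] at this
    · intro hab
      have := hadd (a - b) 0 b hab
      rwa [sub_add_cancel, zero_add] at this
  let χ' : Q.carrier ⧸ N → Q'.carrier := Quotient.lift χ fun a b hab =>
    (hN a b).2 ((Submodule.quotientRel_def N).1 hab)
  have hb : Function.Bijective χ' := by
    constructor
    · rintro ⟨a⟩ ⟨b⟩ hab
      exact (Submodule.Quotient.eq N).2 ((hN a b).1 hab)
    · intro q
      obtain ⟨a, rfl⟩ := hs q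
      exact ⟨Submodule.Quotient.mk a, rfl⟩
  let e := (Equiv.ofBijective χ' hb).symm
  let _ := e.addCommGroup
  let _ := e.module R
  let L : Q.carrier →ₗ[R] Q'.carrier := (e.linearEquiv R).symm.toLinearMap ∘ₗ N.mkQ
  have hL : ∀ a, χ a = L a := fun a => rfl
  refine ⟨R, _, ‹_›, inferInstance, inferInstance, fun n g => ⟨?_, ?_⟩, m, ?_⟩
  · rintro ⟨t, ht⟩
    obtain ⟨c, hc, hc'⟩ := (h n fun x => t.eval Q x).1 ⟨t, fun _ => rfl⟩
    refine ⟨c, hc, fun x => ?_⟩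
    obtain ⟨y, rfl⟩ := hs.comp_left x
    have := hχ.map_eval t y
    rw [hc', hL, map_sum] at this
    rw [← ht]
    refine this.symm.trans (Finset.sum_congr rfl fun i _ => ?_)
    rw [map_smul]
    rfl
  · rintro ⟨c, hc, hg⟩
    obtain ⟨t, ht⟩ := (h n fun x => ∑ i, c i • x i).2 ⟨c, hc, fun _ => rfl⟩
    refine ⟨t, fun x => ?_⟩
    obtain ⟨y, rfl⟩ := hs.comp_left x
    have := hχ.map_eval t y
    rw [ht, hL, map_sum] at this
    rw [hg]
    refine this.symm.trans (Finset.sum_congr rfl fun i _ => ?_)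
    rw [map_smul]
    rfl
  · intro x y z
    obtain ⟨x, rfl⟩ := hs x
    obtain ⟨y, rfl⟩ := hs y
    obtain ⟨z, rfl⟩ := hs z
    rw [← hχ.map_eval₃, hm, hL, map_add, map_sub]
    rfl

theorem IsAffineAlgebra.isStrictlySimple (h : Q.IsAffineAlgebra) (hQ : Q.IsSimple) :
    Q.IsStrictlySimple := by
  obtain ⟨R, _, _, _, _, h, m, hm⟩ := h
  intro S hS x hx y hy hxy
  let N : Submodule R Q.carrier :=
    { carrier := {a | a + x ∈ S}
      zero_mem' := by simpa using hx
      add_mem' := fun {a b} ha hb => by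
        have := hS.eval_mem m ![a + x, x, b + x] fun i => by fin_cases i <;> assumption
        rw [hm] at this
        change a + b + x ∈ S
        convert this using 1
        abel
      smul_mem' := fun r a ha => by
        obtain ⟨t, ht⟩ := (h 2 fun x => ∑ i, ![r, 1 - r] i • x i).2
          ⟨![r, 1 - r], by simp, fun _ => rfl⟩
        have := hS.eval_mem t ![a + x, x] fun i => by fin_cases i <;> assumption
        rw [ht] at this
        change r • a + x ∈ S
        convert this using 1
        simp [sub_smul] }
  let θ : Congruence Q :=
    { rel := fun a b => a - b ∈ N
      refl := fun a => by simp
      symm := fun {a b} hab => by simpa using N.neg_mem hab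
      trans := fun {a b c} hab hbc => by simpa using N.add_mem hab hbc
      compat := fun f a b hab => by
        obtain ⟨c, -, hc⟩ := (h _ fun x => Q.interp f x).1 ⟨.app f .var, fun _ => rfl⟩
        rw [hc, hc, ← Finset.sum_sub_distrib]
        refine N.sum_mem fun i _ => ?_
        rw [← smul_sub]
        exact N.smul_mem _ (hab i) }
  have := hQ.isFull θ hxy.symm (show y - x + x ∈ S by simpa using hy)
  refine Set.eq_univ_of_forall fun z => ?_
  have hz : z - x + x ∈ S := this z x
  simpa using hz

theorem IsAffineAlgebra.not_hasSemilattice (h : Q.IsAffineAlgebra) (hQ : Q.Idempotent)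
    {x y : Q.carrier} (hxy : x ≠ y) : ¬ Q.HasSemilattice x y := by
  rw [hasSemilattice_iff hQ]
  rintro ⟨t, u, -, -, h3, h4, h5, h6⟩
  obtain ⟨R, _, _, _, _, h, -⟩ := h
  obtain ⟨c, hc, hc'⟩ := (h 2 fun x => t.eval Q x).1 ⟨t, fun _ => rfl⟩
  simp only [hc', Fin.sum_univ_two, Matrix.cons_val_zero, Matrix.cons_val_one] at h3 h4 h5 h6 hc
  have key : ∀ z : Q.carrier, c 0 • z + c 1 • z = z := fun z => by rw [← add_smul, hc, one_smul]
  have e1 := (add_right_cancel (h3.trans (key u).symm)).trans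
    (add_right_cancel (h5.trans (key u).symm)).symm
  have e2 := (add_left_cancel (h4.trans (key u).symm)).trans
    (add_left_cancel (h6.trans (key u).symm)).symm
  exact hxy (by rw [← key x, e1, e2, key y])

theorem IsAffineAlgebra.not_hasMajority (h : Q.IsAffineAlgebra)
    {x y : Q.carrier} (hxy : x ≠ y) : ¬ Q.HasMajority x y := fun hm => by
  obtain ⟨t, h1, h2, h3, -⟩ := hm.exists_eq
  obtain ⟨R, _, _, _, _, h, -⟩ := h
  obtain ⟨c, hc, hc'⟩ := (h 3 fun x => t.eval Q x).1 ⟨t, fun _ => rfl⟩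
  simp only [hc', Fin.sum_univ_three, Matrix.cons_val_zero, Matrix.cons_val_one,
    Matrix.cons_val_two, Matrix.tail_cons, Matrix.head_cons] at h1 h2 h3 hc
  have key : ∀ z : Q.carrier, c 0 • z + c 1 • z + c 2 • z = z := fun z => by
    rw [← add_smul, ← add_smul, hc, one_smul]
  have e1 := add_left_cancel (h1.trans (key x).symm)
  have e2 := add_left_cancel (add_right_cancel (h2.trans (key x).symm))
  have e3 := add_right_cancel (add_right_cancel (h3.trans (key x).symm))
  exact hxy (by rw [← key x, ← e1, ← e2, ← e3, key y])

end UAlgebra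

namespace UAlgebra

variable {σ : Signature} {A B Q Q' R : UAlgebra σ}

theorem IsHom.isClosed_image {φ : A.carrier → B.carrier} (h : IsHom A B φ) {S : Set A.carrier}
    (hS : A.IsClosed S) : B.IsClosed (φ '' S) := fun f x hx => by
  choose y hy hyx using hx
  exact ⟨A.interp f y, hS f y hy, by rw [h f, funext hyx]⟩

theorem IsHom.isClosed_preimage {φ : A.carrier → B.carrier} (h : IsHom A B φ)
    {S : Set B.carrier} (hS : B.IsClosed S) : A.IsClosed (φ ⁻¹' S) := fun f x hx => by
  rw [Set.mem_preimage, h f]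
  exact hS f _ hx

theorem isClosed_univ (A : UAlgebra σ) : A.IsClosed Set.univ := fun _ _ _ => trivial

theorem IsStrictlySimple.surjective (hQ : Q.IsStrictlySimple) {φ : A.carrier → Q.carrier}
    (h : IsHom A Q φ) {a b : A.carrier} (hab : φ a ≠ φ b) : Function.Surjective φ := by
  rw [← Set.range_eq_univ, ← Set.image_univ]
  exact hQ _ (h.isClosed_image A.isClosed_univ) _ ⟨a, trivial, rfl⟩ _ ⟨b, trivial, rfl⟩ hab

theorem IsHom.surjective_of_closure {φ : A.carrier → B.carrier} (h : IsHom A B φ)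
    {G : Set B.carrier} (hG : B.ClosureSet G = Set.univ) (hφ : ∀ g ∈ G, ∃ a, φ a = g) :
    Function.Surjective φ := by
  rw [← Set.range_eq_univ, ← Set.image_univ, ← Set.univ_subset_iff, ← hG]
  refine closureSet_subset (h.isClosed_image A.isClosed_univ) fun g hg => ?_
  obtain ⟨a, ha⟩ := hφ g hg
  exact ⟨a, trivial, ha⟩

/-- The property of a simple quotient witnessing that the images of the generators form an edge
of type `τ`. -/
def IsOfType (Q : UAlgebra σ) (τ : EdgeType) (x y : Q.carrier) : Prop :=
  match τ with
  | .unary => Q.IsSetAlgebra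
  | .semilattice => Q.HasSemilattice x y
  | .majority => Q.HasMajority x y ∧ ¬ Q.HasSemilattice x y
  | .affine => Q.IsAffineAlgebra

theorem hasEdgeOfType_iff (τ : EdgeType) (a b : A.carrier) :
    A.HasEdgeOfType τ a b ↔ a ≠ b ∧ ∃ θ : Congruence (A.Sg {a, b}), θ.IsMaximal ∧
      ((A.Sg {a, b}).quot θ).IsOfType τ (A.qa a b θ) (A.qb a b θ) := by
  cases τ <;> rfl

theorem IsOfType.map {τ : EdgeType} {x y : Q.carrier} (h : Q.IsOfType τ x y)
    {α : Q.carrier → Q'.carrier} (hα : IsHom Q Q' α) (sα : Function.Surjective α)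
    {β : Q'.carrier → Q.carrier} (hβ : IsHom Q' Q β)
    (hx : β (α x) = x) (hy : β (α y) = y) : Q'.IsOfType τ (α x) (α y) := by
  cases τ with
  | unary => exact IsSetAlgebra.map hα sα h
  | semilattice => exact HasSemilattice.map hα h
  | majority =>
    refine ⟨h.1.map hα, fun h' => h.2 ?_⟩
    have := h'.map hβ
    rwa [hx, hy] at this
  | affine => exact IsAffineAlgebra.map hα sα h

theorem exists_quot_homs {χ : A.carrier → Q.carrier} (hχ : IsHom A Q χ)
    (hs : Function.Surjective χ) (η : Congruence A) (h : ∀ r s, η.rel r s ↔ χ r = χ s) :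
    (∃ α : Q.carrier → (A.quot η).carrier, IsHom Q (A.quot η) α ∧ Function.Surjective α ∧
      ∀ r, α (χ r) = Quotient.mk η.toSetoid r) ∧
    ∃ β : (A.quot η).carrier → Q.carrier, IsHom (A.quot η) Q β ∧ Function.Surjective β ∧
      ∀ r, β (Quotient.mk η.toSetoid r) = χ r :=
  ⟨exists_isHom_factor hχ η.isHom_mk hs Quotient.mk_surjective fun r s hrs =>
      η.mk_eq_mk.2 ((h r s).2 hrs),
    exists_isHom_factor (Q := A.quot η) η.isHom_mk hχ Quotient.mk_surjective hs fun r s hrs =>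
      (h r s).1 (η.mk_eq_mk.1 hrs)⟩

theorem IsOfType.hasEdgeOfType {τ : EdgeType} {a b : A.carrier}
    {χ : (A.Sg {a, b}).carrier → Q.carrier} (hχ : IsHom _ Q χ) (hs : Function.Surjective χ)
    (hQ : Q.IsSimple) (hne : χ (A.sgA a b) ≠ χ (A.sgB a b))
    (h : Q.IsOfType τ (χ (A.sgA a b)) (χ (A.sgB a b))) : A.HasEdgeOfType τ a b := by
  refine (hasEdgeOfType_iff τ a b).2 ⟨?_, hχ.ker, ?_, ?_⟩
  · rintro rfl
    exact hne rfl
  · exact (hχ.isMaximal_iff hs _ fun _ _ => Iff.rfl).2 ⟨hQ, _, _, hne⟩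
  · obtain ⟨⟨α, hα, sα, e⟩, β, hβ, -, e'⟩ := exists_quot_homs hχ hs hχ.ker fun _ _ => Iff.rfl
    have := h.map hα sα hβ (by rw [e, e']) (by rw [e, e'])
    rwa [e, e] at this

/-- The property of a quotient required of an edge. -/
def IsEdgeQuot (Q : UAlgebra σ) (x y : Q.carrier) : Prop :=
  Q.IsSetAlgebra ∨ Q.IsAffineAlgebra ∨ Q.HasSemilattice x y ∨ Q.HasMajority x y

theorem IsEdgeQuot.map {x y : Q.carrier} (h : Q.IsEdgeQuot x y) {α : Q.carrier → Q'.carrier}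
    (hα : IsHom Q Q' α) (sα : Function.Surjective α) : Q'.IsEdgeQuot (α x) (α y) := by
  rcases h with h | h | h | h
  · exact Or.inl (h.map hα sα)
  · exact Or.inr (Or.inl (h.map hα sα))
  · exact Or.inr (Or.inr (Or.inl (h.map hα)))
  · exact Or.inr (Or.inr (Or.inr (h.map hα)))

theorem IsEdgeQuot.isEdge {a b : A.carrier}
    {χ : (A.Sg {a, b}).carrier → Q.carrier} (hχ : IsHom _ Q χ) (hs : Function.Surjective χ)
    (hne : χ (A.sgA a b) ≠ χ (A.sgB a b))
    (h : Q.IsEdgeQuot (χ (A.sgA a b)) (χ (A.sgB a b))) : A.IsEdge a b := by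
  refine ⟨?_, hχ.ker, fun hf => hne (hf _ _), ?_⟩
  · rintro rfl
    exact hne rfl
  · obtain ⟨α, hα, sα, e⟩ := (exists_quot_homs hχ hs hχ.ker fun _ _ => Iff.rfl).1
    have := h.map hα sα
    rw [e, e] at this
    exact this

theorem eq_of_generators {a b : A.carrier} (hA : A.Idempotent) (θ : Congruence (A.Sg {a, b}))
    (h : θ.rel (A.sgA a b) (A.sgB a b)) : θ.IsFull := by
  have : (A.Sg {a, b}).ClosureSet {A.sgA a b, A.sgB a b} ⊆ {x | θ.rel x (A.sgB a b)} := by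
    refine closureSet_subset (θ.isClosed_class (hA.subalg _ _) _) ?_
    rintro x (rfl | rfl)
    · exact h
    · exact θ.refl _
  rw [closureSet_sg, Set.univ_subset_iff, Set.eq_univ_iff_forall] at this
  exact fun x y => θ.trans (this x) (θ.symm (this y))

theorem IsEdge.exists_isMaximal {a b : A.carrier} (hA : A.Idempotent)
    [Finite (A.Sg {a, b}).carrier] (h : A.IsEdge a b) :
    ∃ η : Congruence (A.Sg {a, b}), η.IsMaximal ∧ A.qa a b η ≠ A.qb a b η ∧
      ((A.Sg {a, b}).quot η).IsEdgeQuot (A.qa a b η) (A.qb a b η) := by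
  obtain ⟨-, θ, hθ, h⟩ := h
  obtain ⟨η, hle, hη⟩ := θ.exists_isMaximal hθ
  refine ⟨η, hη, fun he => hη.1 (eq_of_generators hA η (η.mk_eq_mk.1 he)), ?_⟩
  obtain ⟨α, hα, sα, e⟩ := exists_isHom_factor (Q := (A.Sg {a, b}).quot θ)
    (Q' := (A.Sg {a, b}).quot η) θ.isHom_mk η.isHom_mk Quotient.mk_surjective
    Quotient.mk_surjective fun r s hrs => η.mk_eq_mk.2 (hle _ _ (θ.mk_eq_mk.1 hrs))
  have := IsEdgeQuot.map (x := A.qa a b θ) (y := A.qb a b θ) h hα sα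
  have ea : α (A.qa a b θ) = A.qa a b η := e _
  have eb : α (A.qb a b θ) = A.qb a b η := e _
  rwa [ea, eb] at this

/-- A strictly simple image of a subdirect product is an image of a subalgebra of a factor. -/
theorem exists_isHom_subalg_factor {ι : Type} [Finite ι] {A : ι → UAlgebra σ}
    (hA : ∀ i, (A i).Idempotent) {p : ∀ i, R.carrier → (A i).carrier}
    (hp : ∀ i, IsHom R (A i) (p i)) (inj : ∀ r s, (∀ i, p i r = p i s) → r = s)
    {φ : R.carrier → Q.carrier} (hφ : IsHom R Q φ) (hQ : Q.IsStrictlySimple)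
    {u v : R.carrier} (huv : φ u ≠ φ v) :
    ∃ (i : ι) (S : Set (A i).carrier) (hS : (A i).IsClosed S)
      (ψ : ((A i).subalg S hS).carrier → Q.carrier),
      IsHom ((A i).subalg S hS) Q ψ ∧ Function.Surjective ψ := by
  let g : R.carrier × R.carrier → ℕ := fun w => {i | p i w.1 ≠ p i w.2}.ncard
  obtain ⟨⟨u, v⟩, huv, hmin⟩ := (measure g).wf.has_min {w | φ w.1 ≠ φ w.2} ⟨(u, v), huv⟩
  obtain ⟨i, hi⟩ : ∃ i, p i u ≠ p i v := by
    by_contra! hne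
    exact huv (congrArg φ (inj u v hne))
  let W : Set R.carrier := {r | ∀ j, p j u = p j v → p j r = p j u}
  have hW : R.IsClosed W := fun f x hx j hj => by
    rw [hp j f, funext fun k => hx k j hj]
    exact hA j f _
  let P : (R.subalg W hW).carrier → ((A i).subalg (p i '' W) ((hp i).isClosed_image hW)).carrier :=
    fun r => ⟨p i r.1, r.1, r.2, rfl⟩
  have hP : IsHom (R.subalg W hW) ((A i).subalg (p i '' W) ((hp i).isClosed_image hW)) P :=
    fun f x => Subtype.ext (hp i f _)
  have hφW : IsHom (R.subalg W hW) Q fun r => φ r.1 := hφ.comp (isHom_val W hW)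
  obtain ⟨ψ, h1, h2, -⟩ := exists_isHom_factor hP hφW
    (by
      rintro ⟨_, r, hr, rfl⟩
      exact ⟨⟨r, hr⟩, rfl⟩)
    (hQ.surjective hφW (a := ⟨u, fun _ _ => rfl⟩) (b := ⟨v, fun _ h => h.symm⟩) huv)
    fun r s hrs => by
      by_contra hne
      refine hmin (r.1, s.1) hne (Set.ncard_lt_ncard ⟨fun j hj hj' => hj ?_, fun hsub => ?_⟩
        (Set.toFinite _))
      · exact (r.2 j hj').trans (s.2 j hj').symm
      · exact hsub (show i ∈ {i | p i u ≠ p i v} from hi) (congrArg Subtype.val hrs)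
  exact ⟨i, _, _, ψ, h1, h2⟩

/-- The algebra on `Prop` whose operations are projections. -/
def projAlg (σ : Signature) (sel : ∀ f : σ.ops, Fin (σ.arity f)) : UAlgebra σ where
  carrier := Prop
  interp f x := x (sel f)

theorem projAlg_isSetAlgebra (sel : ∀ f : σ.ops, Fin (σ.arity f)) :
    (projAlg σ sel).IsSetAlgebra := fun n t => by
  induction t with
  | var i => exact ⟨i, fun _ => rfl⟩
  | app f ts ih =>
    obtain ⟨i, hi⟩ := ih (sel f)
    exact ⟨i, hi⟩

theorem eq_or_eq_of_ne_prop {x y : Prop} (h : x ≠ y) (z : Prop) : z = x ∨ z = y := by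
  by_cases hx : x <;> by_cases hy : y <;> by_cases hz : z <;> simp_all

theorem projAlg_isStrictlySimple (sel : ∀ f : σ.ops, Fin (σ.arity f)) :
    (projAlg σ sel).IsStrictlySimple := fun S _ x hx y hy hxy => by
  refine Set.eq_univ_of_forall fun z => ?_
  rcases eq_or_eq_of_ne_prop hxy z with rfl | rfl <;> assumption

theorem projAlg_isSimple (sel : ∀ f : σ.ops, Fin (σ.arity f)) : (projAlg σ sel).IsSimple :=
  fun θ => by
    by_cases h : ∃ x y, θ.rel x y ∧ x ≠ y
    · obtain ⟨x, y, h, hxy⟩ := h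
      have key : ∀ z, θ.rel z x := fun z => by
        rcases eq_or_eq_of_ne_prop hxy z with rfl | rfl
        · exact θ.refl _
        · exact θ.symm h
      exact Or.inr fun z w => θ.trans (key z) (θ.symm (key w))
    · push Not at h
      exact Or.inl fun x y => ⟨h x y, fun hxy => hxy ▸ θ.refl x⟩

/-- A subdirect product of algebras omitting type 1 has no two-element set as an image. -/
theorem not_isHom_projAlg {ι : Type} [Finite ι] {A : ι → UAlgebra σ}
    (hA : ∀ i, (A i).Idempotent) (h1 : ∀ i, (A i).OmitsType1)
    {p : ∀ i, R.carrier → (A i).carrier}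
    (hp : ∀ i, IsHom R (A i) (p i)) (inj : ∀ r s, (∀ i, p i r = p i s) → r = s)
    {sel : ∀ f : σ.ops, Fin (σ.arity f)} {φ : R.carrier → Prop}
    (hφ : IsHom R (projAlg σ sel) φ) {u v : R.carrier} (huv : φ u ≠ φ v) : False := by
  obtain ⟨i, S, hS, ψ, hψ, hs⟩ := exists_isHom_subalg_factor hA hp inj hφ
    (projAlg_isStrictlySimple sel) huv
  obtain ⟨c, hc⟩ := hs True
  obtain ⟨d, hd⟩ := hs False
  have hχ := hψ.comp (isHom_val _ (((A i).subalg S hS).closureSet_isClosed {c, d}))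
  have hne : (ψ c : Prop) ≠ ψ d := by
    rw [hc, hd]
    exact true_ne_false
  exact h1 i S hS c d <| IsOfType.hasEdgeOfType (τ := .unary) (a := c) (b := d) hχ
    ((projAlg_isStrictlySimple sel).surjective hχ (a := UAlgebra.sgA _ c d)
      (b := UAlgebra.sgB _ c d) hne)
    (projAlg_isSimple sel) hne (projAlg_isSetAlgebra sel)

/-- A strictly simple image of a subalgebra is seen by some edge of the algebra. -/
theorem Restricted.exists_isOfType [Finite A.carrier] (hA : A.Idempotent) {T : Set EdgeType}
    (hT : A.Restricted T) {S : Set A.carrier} {hS : A.IsClosed S}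
    {ψ : (A.subalg S hS).carrier → Q.carrier} (hψ : IsHom _ Q ψ) (sψ : Function.Surjective ψ)
    (hQ : Q.IsStrictlySimple) (hne : ∃ x y : Q.carrier, x ≠ y)
    (he : ∀ x y : Q.carrier, x ≠ y → Q.IsEdgeQuot x y) :
    ∃ τ ∈ T, ∃ x y : Q.carrier, x ≠ y ∧ Q.IsOfType τ x y := by
  let g : (A.subalg S hS).carrier × (A.subalg S hS).carrier → ℕ := fun w =>
    (A.ClosureSet {w.1.1, w.2.1}).ncard
  obtain ⟨⟨c, d⟩, hcd, hmin⟩ := (measure g).wf.has_min {w | ψ w.1 ≠ ψ w.2} (by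
    obtain ⟨x, y, hxy⟩ := hne
    obtain ⟨c, rfl⟩ := sψ x
    obtain ⟨d, rfl⟩ := sψ y
    exact ⟨(c, d), hxy⟩)
  have hsub : A.ClosureSet {c.1, d.1} ⊆ S := closureSet_subset hS (by
    rintro x (rfl | rfl)
    · exact c.2
    · exact d.2)
  let ε : (A.Sg {c.1, d.1}).carrier → (A.subalg S hS).carrier := fun r => ⟨r.1, hsub r.2⟩
  have hε : IsHom (A.Sg {c.1, d.1}) (A.subalg S hS) ε := fun _ _ => rfl
  have hχ := hψ.comp hε
  have hs := hQ.surjective hχ (a := A.sgA c.1 d.1) (b := A.sgB c.1 d.1) hcd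
  obtain ⟨τ, hτ, h⟩ := hT c.1 d.1 (IsEdgeQuot.isEdge hχ hs hcd (he _ _ hcd))
  obtain ⟨-, η, hη, h⟩ := (hasEdgeOfType_iff τ c.1 d.1).1 h
  have hle : η.le hχ.ker := fun r s hrs => by
    by_contra hne
    have hsub' : A.ClosureSet {r.1, s.1} ⊆ Subtype.val '' {x | η.rel x s} := by
      refine closureSet_subset ((isHom_val _ _).isClosed_image
        (η.isClosed_class (hA.subalg _ _) s)) ?_
      rintro x (rfl | rfl)
      · exact ⟨r, hrs, rfl⟩
      · exact ⟨s, η.refl s, rfl⟩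
    refine hmin (ε r, ε s) hne (Set.ncard_lt_ncard ⟨fun x hx => ?_, fun hx => hη.1 ?_⟩
      (Set.toFinite _))
    · obtain ⟨y, -, rfl⟩ := hsub' hx
      exact y.2
    · have key : ∀ x, η.rel x s := fun x => by
        obtain ⟨y, hy, e⟩ := hsub' (hx x.2)
        rwa [Subtype.ext e] at hy
      exact fun x y => η.trans (key x) (η.symm (key y))
  have hge := hη.2 hχ.ker hle fun hf => hcd (hf (A.sgA c.1 d.1) (A.sgB c.1 d.1))
  obtain ⟨⟨α, hα, -, e⟩, β, hβ, sβ, e'⟩ :=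
    exists_quot_homs hχ hs η fun r s => ⟨hle r s, hge r s⟩
  refine ⟨τ, hτ, _, _, hcd, ?_⟩
  have ea : β (A.qa c.1 d.1 η) = ψ c := e' _
  have eb : β (A.qb c.1 d.1 η) = ψ d := e' _
  have ea' : α (ψ c) = A.qa c.1 d.1 η := e (A.sgA c.1 d.1)
  have eb' : α (ψ d) = A.qb c.1 d.1 η := e (A.sgB c.1 d.1)
  have := h.map hβ sβ hα (by rw [ea, ea']) (by rw [eb, eb'])
  rwa [ea, eb] at this

end UAlgebra

/-- On a finite type some iterate of every self-map is idempotent, uniformly. -/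
theorem exists_iterate_idempotent (α : Type*) [Finite α] :
    ∃ N, 0 < N ∧ ∀ (f : α → α) (x : α), f^[N] (f^[N] x) = f^[N] x := by
  classical
  have := Fintype.ofFinite (α → α)
  have h : ∀ f : α → α, ∃ a d, 0 < d ∧ f^[a + d] = f^[a] := fun f => by
    obtain ⟨m, n, hmn, he⟩ := Finite.exists_ne_map_eq_of_infinite fun n => f^[n]
    rcases lt_or_gt_of_ne hmn with h | h
    · exact ⟨m, n - m, by omega, by rw [Nat.add_sub_cancel' h.le]; exact he.symm⟩
    · exact ⟨n, m - n, by omega, by rw [Nat.add_sub_cancel' h.le]; exact he⟩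
  choose a d hd had using h
  have hpos : ∀ f, 0 < d f * (a f + 1) := fun f => Nat.mul_pos (hd f) (Nat.succ_pos _)
  refine ⟨∏ f, d f * (a f + 1), Finset.prod_pos fun f _ => hpos f, fun f x => ?_⟩
  obtain ⟨k, hk⟩ := Finset.dvd_prod_of_mem (fun f => d f * (a f + 1)) (Finset.mem_univ f)
  have hN : 0 < ∏ f, d f * (a f + 1) := Finset.prod_pos fun f _ => hpos f
  generalize (∏ f, d f * (a f + 1)) = N at hk hN
  have hper : ∀ j n, a f ≤ n → f^[n + d f * j] = f^[n] := fun j => by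
    induction j with
    | zero => simp
    | succ j ih =>
      intro n hn
      rw [show n + d f * (j + 1) = (n + d f) + d f * j by ring, ih _ (by omega)]
      obtain ⟨e, rfl⟩ := Nat.exists_eq_add_of_le hn
      rw [show a f + e + d f = e + (a f + d f) by ring, Function.iterate_add, had,
        ← Function.iterate_add, add_comm]
  rw [← Function.iterate_add_apply]
  have hle : a f ≤ N := by
    have : d f * (a f + 1) ≤ N := Nat.le_of_dvd hN ⟨k, hk⟩
    nlinarith [hd f]
  have e := hper ((a f + 1) * k) N hle
  rw [← mul_assoc, ← hk] at e
  rw [e]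

namespace Term

variable {σ : Signature}

/-- Iteration of a binary term in its second variable. -/
def iter (t : Term σ 2) : ℕ → Term σ 2
  | 0 => .var 1
  | k + 1 => t.subst₂ (.var 0) (t.iter k)

theorem eval_iter (A : UAlgebra σ) (t : Term σ 2) (k : ℕ) (a b : A.carrier) :
    (t.iter k).eval A ![a, b] = (fun z => t.eval A ![a, z])^[k] b := by
  induction k with
  | zero => rfl
  | succ k ih =>
    rw [Function.iterate_succ_apply', ← ih, iter, eval_subst₂]
    rfl

end Term

namespace UAlgebra

variable {σ : Signature} {A Q R : UAlgebra σ} {T : Set EdgeType}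

theorem Restricted.semilattice_mem_of_eval [Finite A.carrier] (hA : A.Idempotent)
    (hres : A.Restricted T) (hT : EdgeType.unary ∉ T) {c d : A.carrier} (hcd : c ≠ d)
    (t : Term σ 2) (h1 : t.eval A ![c, d] = d) (h2 : t.eval A ![d, c] = d) :
    EdgeType.semilattice ∈ T := by
  have hv := isHom_val (A := A) _ (A.closureSet_isClosed {c, d})
  have hi := hA.subalg _ (A.closureSet_isClosed {c, d})
  have hsl : (A.Sg {c, d}).HasSemilattice (A.sgA c d) (A.sgB c d) := by
    have e1 : t.eval (A.Sg {c, d}) ![A.sgA c d, A.sgB c d] = A.sgB c d :=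
      Subtype.ext ((hv.map_eval₂ t _ _).trans h1)
    have e2 : t.eval (A.Sg {c, d}) ![A.sgB c d, A.sgA c d] = A.sgB c d :=
      Subtype.ext ((hv.map_eval₂ t _ _).trans h2)
    have e3 : t.eval (A.Sg {c, d}) ![A.sgB c d, A.sgB c d] = A.sgB c d := hi.eval_pair _ _
    exact (hasSemilattice_iff hi).2 ⟨t, A.sgB c d, e1, e2, e1, e2, e3, e3⟩
  obtain ⟨τ, hτ, h⟩ := hres c d (IsEdgeQuot.isEdge (Q := A.Sg {c, d}) (χ := id)
    (fun _ _ => rfl) Function.surjective_id (fun h => hcd (congrArg Subtype.val h))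
    (Or.inr (Or.inr (Or.inl hsl))))
  obtain ⟨-, η, hη, h⟩ := (hasEdgeOfType_iff τ c d).1 h
  have hsl' : ((A.Sg {c, d}).quot η).HasSemilattice (A.qa c d η) (A.qb c d η) :=
    hsl.map η.isHom_mk
  cases τ with
  | unary => exact absurd hτ hT
  | semilattice => exact hτ
  | majority => exact absurd hsl' h.2
  | affine =>
    exact absurd hsl' (IsAffineAlgebra.not_hasSemilattice h
      (hi.of_surjective η.isHom_mk Quotient.mk_surjective)
      fun he => hη.1 (eq_of_generators hA η (η.mk_eq_mk.1 he)))

theorem semilattice_mem {ι : Type} {A : ι → UAlgebra σ} [∀ i, Finite (A i).carrier]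
    (hA : ∀ i, (A i).Idempotent) (hres : ∀ i, (A i).Restricted T)
    (hT : EdgeType.unary ∉ T) [Finite R.carrier] (hR : R.Idempotent)
    {p : ∀ i, R.carrier → (A i).carrier}
    (hp : ∀ i, IsHom R (A i) (p i)) (inj : ∀ r s, (∀ i, p i r = p i s) → r = s)
    {φ : R.carrier → Q.carrier} (hφ : IsHom R Q φ) (hs : Function.Surjective φ)
    {x y : Q.carrier} (hxy : x ≠ y) (h : Q.HasSemilattice x y) :
    EdgeType.semilattice ∈ T := by
  have hQ := hR.of_surjective hφ hs
  obtain ⟨t, c, d, hne, h1, h2⟩ : ∃ (t : Term σ 2) (c d : R.carrier), φ c ≠ φ d ∧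
      t.eval Q ![φ c, φ d] = φ d ∧ t.eval Q ![φ d, φ c] = φ d := by
    obtain ⟨t, u, h1, h2, h3, h4, -, -⟩ := (hasSemilattice_iff hQ).1 h
    obtain ⟨c, rfl⟩ := hs x
    obtain ⟨d, rfl⟩ := hs y
    obtain ⟨e, rfl⟩ := hs u
    by_cases hu : φ e = φ c
    · rw [hu] at h1 h2
      exact ⟨t, d, c, hxy.symm, h2, h1⟩
    · exact ⟨t, c, e, Ne.symm hu, h3, h4⟩
  obtain ⟨N, hN, hpow⟩ := exists_iterate_idempotent R.carrier
  obtain ⟨M, rfl⟩ := Nat.exists_eq_succ_of_ne_zero hN.ne'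
  set m := t.iter (M + 1) with hm
  have mm : ∀ a b, m.eval R ![a, m.eval R ![a, b]] = m.eval R ![a, b] := fun a b => by
    simp only [hm, Term.eval_iter]
    exact hpow _ b
  have m1 : m.eval Q ![φ c, φ d] = φ d := by
    rw [hm, Term.eval_iter]
    exact Function.iterate_fixed h1 _
  have m2 : m.eval Q ![φ d, φ c] = φ d := by
    rw [hm, Term.eval_iter, Function.iterate_succ_apply]
    rw [h2]
    exact Function.iterate_fixed (hQ.eval_pair t _) _
  set w : Term σ 2 := m.subst₂ (.var 0) (m.subst₂ (.var 1) (.var 0)) with hw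
  have hwe : ∀ (B : UAlgebra σ) (a b : B.carrier),
      w.eval B ![a, b] = m.eval B ![a, m.eval B ![b, a]] := fun B a b => by
    rw [hw, Term.eval_subst₂, Term.eval_subst₂]
    rfl
  set g := w.iter (M + 1) with hg
  set e := g.eval R ![c, d] with he
  have e1 : g.eval R ![c, e] = e := by
    rw [he, hg]
    simp only [Term.eval_iter]
    exact hpow _ d
  have e2 : m.eval R ![c, e] = e := by
    obtain ⟨z, hz⟩ : ∃ z, e = w.eval R ![c, z] :=
      ⟨_, by rw [he, hg, Term.eval_iter, Function.iterate_succ_apply']⟩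
    rw [hz, hwe, mm]
  have e3 : g.eval R ![e, c] = e := by
    rw [hg, Term.eval_iter, Function.iterate_succ_apply]
    rw [hwe, e2, hR.eval_pair]
    refine Function.iterate_fixed ?_ _
    rw [hwe, hR.eval_pair, hR.eval_pair]
  have e4 : φ e = φ d := by
    rw [he, hφ.map_eval₂, hg, Term.eval_iter]
    refine Function.iterate_fixed ?_ _
    rw [hwe, m2, m1]
  obtain ⟨i, hi⟩ : ∃ i, p i c ≠ p i e := by
    by_contra! hce
    exact hne (by rw [inj _ _ hce, e4])
  exact (hres i).semilattice_mem_of_eval (hA i) hT hi g (by rw [← (hp i).map_eval₂, e1])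
    (by rw [← (hp i).map_eval₂, e3])

end UAlgebra

namespace UAlgebra

variable {σ : Signature} {A Q R : UAlgebra σ} {X Y : Type}

/-- The functions `X → A` obtained from `B` and the constants by the operations of `A`. -/
inductive IsPoly (A : UAlgebra σ) (B : Set (X → A.carrier)) : (X → A.carrier) → Prop
  | base {b : X → A.carrier} : b ∈ B → IsPoly A B b
  | const (c : A.carrier) : IsPoly A B fun _ => c
  | app (f : σ.ops) (g : Fin (σ.arity f) → X → A.carrier) :
      (∀ j, IsPoly A B (g j)) → IsPoly A B fun x => A.interp f fun j => g j x

/-- Unary polynomial operations. -/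
def IsPoly1 (A : UAlgebra σ) (f : A.carrier → A.carrier) : Prop := A.IsPoly {id} f

/-- Binary polynomial operations. -/
def IsPoly2 (A : UAlgebra σ) (f : A.carrier → A.carrier → A.carrier) : Prop :=
  A.IsPoly {Prod.fst, Prod.snd} fun z => f z.1 z.2

theorem IsPoly.comp {B : Set (X → A.carrier)} {B' : Set (Y → A.carrier)} {g : X → A.carrier}
    (hg : A.IsPoly B g) {k : Y → X} (hk : ∀ b ∈ B, A.IsPoly B' fun y => b (k y)) :
    A.IsPoly B' fun y => g (k y) := by
  induction hg with
  | base hb => exact hk _ hb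
  | const c => exact .const c
  | app f g _ ih => exact .app f _ ih

theorem IsPoly.eval {B : Set (X → A.carrier)} {n : ℕ} (t : Term σ n)
    {g : Fin n → X → A.carrier} (hg : ∀ i, A.IsPoly B (g i)) :
    A.IsPoly B fun x => t.eval A fun i => g i x := by
  induction t with
  | var i => exact hg i
  | app f ts ih => exact .app f _ ih

theorem IsPoly.eval₃ {B : Set (X → A.carrier)} (t : Term σ 3) {f g h : X → A.carrier}
    (hf : A.IsPoly B f) (hg : A.IsPoly B g) (hh : A.IsPoly B h) :
    A.IsPoly B fun x => t.eval A ![f x, g x, h x] := by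
  convert IsPoly.eval t (g := ![f, g, h]) (B := B) _ using 3 with x
  · funext i
    fin_cases i <;> rfl
  · intro i
    fin_cases i <;> assumption

theorem isPoly1_id (A : UAlgebra σ) : A.IsPoly1 fun x => x := .base rfl

theorem isPoly2_fst (A : UAlgebra σ) :
    A.IsPoly {Prod.fst, Prod.snd} (Prod.fst : A.carrier × A.carrier → A.carrier) :=
  .base (Or.inl rfl)

theorem isPoly2_snd (A : UAlgebra σ) :
    A.IsPoly {Prod.fst, Prod.snd} (Prod.snd : A.carrier × A.carrier → A.carrier) :=
  .base (Or.inr rfl)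

theorem IsPoly1.comp {B : Set (X → A.carrier)} {f : A.carrier → A.carrier} (hf : A.IsPoly1 f)
    {g : X → A.carrier} (hg : A.IsPoly B g) : A.IsPoly B fun x => f (g x) :=
  IsPoly.comp hf fun b hb => by
    cases hb
    exact hg

theorem IsPoly2.comp {B : Set (X → A.carrier)} {f : A.carrier → A.carrier → A.carrier}
    (hf : A.IsPoly2 f) {g h : X → A.carrier} (hg : A.IsPoly B g) (hh : A.IsPoly B h) :
    A.IsPoly B fun x => f (g x) (h x) :=
  IsPoly.comp (k := fun x => (g x, h x)) hf fun b hb => by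
    rcases hb with rfl | rfl
    · exact hg
    · exact hh

theorem IsPoly2.left {f : A.carrier → A.carrier → A.carrier} (hf : A.IsPoly2 f)
    (a : A.carrier) : A.IsPoly1 (f a) := hf.comp (.const a) A.isPoly1_id

theorem IsPoly2.right {f : A.carrier → A.carrier → A.carrier} (hf : A.IsPoly2 f)
    (a : A.carrier) : A.IsPoly1 fun x => f x a := hf.comp A.isPoly1_id (.const a)

theorem IsPoly1.iterate {f : A.carrier → A.carrier} (hf : A.IsPoly1 f) (n : ℕ) :
    A.IsPoly1 f^[n] := by
  induction n with
  | zero => exact A.isPoly1_id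
  | succ n ih =>
    rw [Function.iterate_succ']
    exact hf.comp ih

theorem IsPoly2.iterate {B : Set (X → A.carrier)} {f : A.carrier → A.carrier → A.carrier}
    (hf : A.IsPoly2 f) {g h : X → A.carrier} (hg : A.IsPoly B g) (hh : A.IsPoly B h) (n : ℕ) :
    A.IsPoly B fun x => (f (g x))^[n] (h x) := by
  induction n with
  | zero => exact hh
  | succ n ih =>
    simp only [Function.iterate_succ_apply']
    exact hf.comp hg ih

theorem Congruence.rel_of_isPoly (θ : Congruence A) {B : Set (X → A.carrier)}
    {g : X → A.carrier} (hg : A.IsPoly B g) {x y : X} (h : ∀ b ∈ B, θ.rel (b x) (b y)) :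
    θ.rel (g x) (g y) := by
  induction hg with
  | base hb => exact h _ hb
  | const c => exact θ.refl c
  | app f g _ ih => exact θ.compat f _ _ ih

theorem Congruence.rel_of_isPoly1 (θ : Congruence A) {f : A.carrier → A.carrier}
    (hf : A.IsPoly1 f) {a b : A.carrier} (h : θ.rel a b) : θ.rel (f a) (f b) :=
  θ.rel_of_isPoly hf fun b hb => by
    cases hb
    exact h

theorem IsPoly.exists_lift {φ : R.carrier → Q.carrier} (hφ : IsHom R Q φ)
    (hs : Function.Surjective φ) {B : Set (X → Q.carrier)} {B' : Set (Y → R.carrier)} {k : Y → X}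
    (hB : ∀ b ∈ B, ∃ b' ∈ B', ∀ y, φ (b' y) = b (k y)) {g : X → Q.carrier}
    (hg : Q.IsPoly B g) : ∃ g', R.IsPoly B' g' ∧ ∀ y, φ (g' y) = g (k y) := by
  induction hg with
  | base hb =>
    obtain ⟨b', hb', h⟩ := hB _ hb
    exact ⟨b', .base hb', h⟩
  | const c =>
    obtain ⟨r, rfl⟩ := hs c
    exact ⟨_, .const r, fun _ => rfl⟩
  | app f g _ ih =>
    choose g' hg' h using ih
    exact ⟨_, .app f g' hg', fun y =>
      (hφ f _).trans (congrArg (Q.interp f) (funext fun j => h j y))⟩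

theorem IsPoly1.exists_lift {φ : R.carrier → Q.carrier} (hφ : IsHom R Q φ)
    (hs : Function.Surjective φ) {g : Q.carrier → Q.carrier} (hg : Q.IsPoly1 g) :
    ∃ g', R.IsPoly1 g' ∧ ∀ r, φ (g' r) = g (φ r) :=
  IsPoly.exists_lift (k := φ) (B' := {id}) hφ hs
    (fun b hb => ⟨id, rfl, fun y => by cases hb; rfl⟩) hg

theorem IsPoly2.exists_lift {φ : R.carrier → Q.carrier} (hφ : IsHom R Q φ)
    (hs : Function.Surjective φ) {g : Q.carrier → Q.carrier → Q.carrier} (hg : Q.IsPoly2 g) :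
    ∃ g', R.IsPoly2 g' ∧ ∀ r s, φ (g' r s) = g (φ r) (φ s) := by
  obtain ⟨g', h, h'⟩ := IsPoly.exists_lift (k := fun z : R.carrier × R.carrier => (φ z.1, φ z.2))
    (B' := {Prod.fst, Prod.snd}) hφ hs (by
      rintro b (rfl | rfl)
      · exact ⟨_, Or.inl rfl, fun _ => rfl⟩
      · exact ⟨_, Or.inr rfl, fun _ => rfl⟩) hg
  exact ⟨fun r s => g' (r, s), h, fun r s => h' (r, s)⟩

/-- An equivalence relation preserved by the unary polynomials is a congruence. -/
def Congruence.ofIsPoly1 (r : A.carrier → A.carrier → Prop) (hr : Equivalence r)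
    (h : ∀ f, A.IsPoly1 f → ∀ a b, r a b → r (f a) (f b)) : Congruence A where
  rel := r
  refl := hr.refl
  symm := hr.symm
  trans := hr.trans
  compat f x y hxy := by
    classical
    have key : ∀ s : Finset (Fin (σ.arity f)), r (A.interp f x) (A.interp f (s.piecewise y x)) := by
      intro s
      induction s using Finset.induction_on with
      | empty => simpa using hr.refl _
      | insert j s hj ih =>
        refine hr.trans ih ?_
        rw [Finset.piecewise_insert]
        have hp : A.IsPoly1 fun z => A.interp f (Function.update (s.piecewise y x) j z) := by
          refine IsPoly.app f (fun i z => Function.update (s.piecewise y x) j z i) fun i => ?_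
          by_cases hi : i = j
          · subst hi
            simp only [Function.update_self]
            exact A.isPoly1_id
          · simpa [hi] using IsPoly.const _
        have := h _ hp _ _ (hxy j)
        convert this using 2
        rw [eq_comm, Function.update_eq_self_iff]
        simp [hj]
    simpa using key Finset.univ

/-- In a simple algebra any two elements are joined by a chain of images of a fixed pair. -/
theorem IsSimple.iff_of_forall (hQ : Q.IsSimple) {u v : Q.carrier} (huv : u ≠ v)
    {P : Q.carrier → Prop} (hP : ∀ k, Q.IsPoly1 k → (P (k u) ↔ P (k v))) (a b : Q.carrier) :
    P a ↔ P b := by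
  let θ := Congruence.ofIsPoly1 (A := Q)
    (fun a b => ∀ P : Q.carrier → Prop, (∀ k, Q.IsPoly1 k → (P (k u) ↔ P (k v))) → (P a ↔ P b))
    ⟨fun _ _ _ => Iff.rfl, fun h P hP => (h P hP).symm,
      fun h h' P hP => (h P hP).trans (h' P hP)⟩
    fun f hf a b hab P hP => hab (fun z => P (f z)) fun k hk => hP _ (hf.comp hk)
  exact hQ.isFull θ huv (fun P hP => hP _ Q.isPoly1_id) a b P hP

theorem IsSimple.eq_of_forall (hQ : Q.IsSimple) {u v : Q.carrier} (huv : u ≠ v) {β : Type}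
    {F : Q.carrier → β} (hF : ∀ k, Q.IsPoly1 k → F (k u) = F (k v)) (a b : Q.carrier) :
    F a = F b :=
  (hQ.iff_of_forall huv (P := fun z => F z = F b) (fun k hk => by rw [hF k hk]) a b).2 rfl

/-- `U` is a minimal set of `Q`, the image of the idempotent polynomial `e`. -/
structure IsMinimalSet (Q : UAlgebra σ) (U : Set Q.carrier) (e : Q.carrier → Q.carrier) :
    Prop where
  isPoly1 : Q.IsPoly1 e
  mem : ∀ x, e x ∈ U
  eq : ∀ x ∈ U, e x = x
  sep : ∀ a b, a ≠ b → ∃ h, Q.IsPoly1 h ∧ (∀ x, h x ∈ U) ∧ h a ≠ h b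
  const_or_injOn : ∀ f, Q.IsPoly1 f → (∀ x, f x ∈ U) →
    (∀ a ∈ U, ∀ b ∈ U, f a = f b) ∨ Set.InjOn f U

theorem IsSimple.exists_isMinimalSet [Finite Q.carrier] (hQ : Q.IsSimple)
    (hne : ∃ x y : Q.carrier, x ≠ y) : ∃ U e, Q.IsMinimalSet U e := by
  obtain ⟨p, ⟨hp, x, y, hxy⟩, hmin⟩ :=
    (measure fun p : Q.carrier → Q.carrier => (Set.range p).ncard).wf.has_min
      {p | Q.IsPoly1 p ∧ ∃ x y, p x ≠ p y} ⟨_, Q.isPoly1_id, hne⟩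
  have sep : ∀ a b, a ≠ b → ∃ h, Q.IsPoly1 h ∧ (∀ x, h x ∈ Set.range p) ∧ h a ≠ h b := by
    intro a b hab
    by_contra! hcon
    exact hxy (hQ.eq_of_forall hab
      (fun k hk => hcon _ (hp.comp hk) fun z => ⟨k z, rfl⟩) x y)
  have coi : ∀ f, Q.IsPoly1 f → (∀ x, f x ∈ Set.range p) →
      (∀ a ∈ Set.range p, ∀ b ∈ Set.range p, f a = f b) ∨ Set.InjOn f (Set.range p) := by
    intro f hf _
    by_contra! hcon
    obtain ⟨⟨_, ⟨a, rfl⟩, _, ⟨b, rfl⟩, hab⟩, hinj⟩ := hcon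
    refine hmin (fun z => f (p z)) ⟨hf.comp hp, a, b, hab⟩ ?_
    have hr : Set.range (fun z => f (p z)) = f '' Set.range p := by
      rw [← Set.range_comp]
      rfl
    change (Set.range fun z => f (p z)).ncard < _
    rw [hr]
    exact lt_of_le_of_ne (Set.ncard_image_le (Set.toFinite _)) fun he =>
      hinj ((Set.ncard_image_iff (Set.toFinite _)).1 he)
  obtain ⟨h, hh, hU, hne'⟩ := sep _ _ hxy
  have hinj : Set.InjOn h (Set.range p) := (coi h hh hU).resolve_left fun hc =>
    hne' (hc _ ⟨x, rfl⟩ _ ⟨y, rfl⟩)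
  obtain ⟨N, hN, hpow⟩ := exists_iterate_idempotent Q.carrier
  have hmap : Set.MapsTo h (Set.range p) (Set.range p) := fun z _ => hU z
  refine ⟨Set.range p, h^[N], hh.iterate N, fun z => ?_, fun z hz => ?_, sep, coi⟩
  · obtain ⟨M, rfl⟩ := Nat.exists_eq_succ_of_ne_zero hN.ne'
    rw [Function.iterate_succ_apply']
    exact hU _
  · exact hinj.iterate hmap N (hmap.iterate N hz) hz (hpow h z)

end UAlgebra

namespace UAlgebra

variable {σ : Signature} {Q : UAlgebra σ} {U : Set Q.carrier} {e : Q.carrier → Q.carrier}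

theorem IsMinimalSet.injOn (hU : Q.IsMinimalSet U e) {u v : Q.carrier} (hu : u ∈ U) (hv : v ∈ U)
    {f : Q.carrier → Q.carrier} (hf : Q.IsPoly1 f) (hfU : ∀ x, f x ∈ U) (h : f u ≠ f v) :
    Set.InjOn f U :=
  (hU.const_or_injOn f hf hfU).resolve_left fun hc => h (hc u hu v hv)

theorem iterate_eq_self_of_injOn {α : Type*} {U : Set α} {f : α → α} {N : ℕ}
    {x : α} (h : f^[N] (f^[N] x) = f^[N] x) (hinj : Set.InjOn f U) (hmap : Set.MapsTo f U U)
    (hx : x ∈ U) : f^[N] x = x :=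
  hinj.iterate hmap N (hmap.iterate N hx) hx h

/-- With a majority operation, collapsing a pair of a minimal set by a translation of a binary
polynomial depends on the translation. -/
theorem IsMinimalSet.exists_isPoly2 [Finite Q.carrier] (hQ : Q.IsSimple) (hi : Q.Idempotent)
    (hU : Q.IsMinimalSet U e) {x y : Q.carrier} (hxy : x ≠ y) (hm : Q.HasMajority x y)
    {u v : Q.carrier} (hu : u ∈ U) (hv : v ∈ U) (huv : u ≠ v) :
    ∃ B, Q.IsPoly2 B ∧ (∀ a b, B a b ∈ U) ∧ ∃ c d, B c u = B c v ∧ B d u ≠ B d v := by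
  by_contra! hcon
  obtain ⟨t, h1, h2, h3, h4, h5, h6⟩ := hm.exists_eq
  obtain ⟨h, hh, hhU, hne⟩ := hU.sep x y hxy
  obtain ⟨k, hk, hk'⟩ : ∃ k, Q.IsPoly1 k ∧
      h (t.eval Q ![x, y, k u]) ≠ h (t.eval Q ![x, y, k v]) := by
    by_contra! hc
    have := hQ.eq_of_forall huv (F := fun z => h (t.eval Q ![x, y, z])) hc x y
    simp only [h2, h6] at this
    exact hne this
  have inj1 : ∀ c, h (t.eval Q ![c, y, k u]) ≠ h (t.eval Q ![c, y, k v]) := fun c hc =>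
    hk' (hcon (fun a b => h (t.eval Q ![a, y, k b]))
      (hh.comp (.eval₃ t Q.isPoly2_fst (.const y) (hk.comp Q.isPoly2_snd)))
      (fun _ _ => hhU _) c x hc)
  obtain ⟨l, hl, hl'⟩ : ∃ l, Q.IsPoly1 l ∧
      h (t.eval Q ![l u, y, x]) ≠ h (t.eval Q ![l v, y, x]) := by
    by_contra! hc
    have := hQ.eq_of_forall huv (F := fun z => h (t.eval Q ![z, y, x])) hc x y
    simp only [h2] at this
    rw [h4] at this
    exact hne this
  have inj2 : ∀ c, h (t.eval Q ![l u, y, c]) ≠ h (t.eval Q ![l v, y, c]) := fun c hc =>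
    hl' (hcon (fun a b => h (t.eval Q ![l b, y, a]))
      (hh.comp (.eval₃ t (hl.comp Q.isPoly2_snd) (.const y) Q.isPoly2_fst))
      (fun _ _ => hhU _) c x hc)
  let m : Q.carrier → Q.carrier → Q.carrier := fun a b => h (t.eval Q ![l a, y, k b])
  have hm : Q.IsPoly2 m :=
    hh.comp (.eval₃ t (hl.comp Q.isPoly2_fst) (.const y) (hk.comp Q.isPoly2_snd))
  have mU : ∀ a b, m a b ∈ U := fun _ _ => hhU _
  have minj1 : ∀ a, Set.InjOn (m a) U := fun a =>
    hU.injOn hu hv (hm.left a) (mU a) (inj1 (l a))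
  have minj2 : ∀ b, Set.InjOn (fun a => m a b) U := fun b =>
    hU.injOn hu hv (hm.right b) (fun a => mU a b) (inj2 (k b))
  obtain ⟨N, hN, hpow⟩ := exists_iterate_idempotent Q.carrier
  obtain ⟨N, rfl⟩ := Nat.exists_eq_succ_of_ne_zero hN.ne'
  let lam : Q.carrier → Q.carrier := fun a => (m a)^[N] u
  have hlam : ∀ a, m a (lam a) = u := fun a => by
    have := iterate_eq_self_of_injOn (hpow (m a) u) (minj1 a) (fun b _ => mU a b) hu
    rwa [Function.iterate_succ_apply'] at this
  have key : ∀ q, Q.IsPoly1 q → ∀ b b', h (t.eval Q ![x, b, q u]) = h (t.eval Q ![x, b', q u]) →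
      h (t.eval Q ![x, b, q v]) = h (t.eval Q ![x, b', q v]) := by
    intro q hq b b' hb
    have hp : Q.IsPoly {Prod.fst, Prod.snd}
        fun z : Q.carrier × Q.carrier => h (t.eval Q ![x, z.1, q z.2]) :=
      hh.comp (.eval₃ t (.const x) Q.isPoly2_fst (hq.comp Q.isPoly2_snd))
    have hp' : Q.IsPoly {Prod.fst, Prod.snd}
        fun z : Q.carrier × Q.carrier => h (t.eval Q ![x, b, q z.2]) :=
      hh.comp (.eval₃ t (.const x) (.const b) (hq.comp Q.isPoly2_snd))
    have := hcon (fun a z => m (h (t.eval Q ![x, a, q z])) (lam (h (t.eval Q ![x, b, q z]))))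
      (hm.comp hp (hm.iterate hp' (.const u) N)) (fun _ _ => mU _ _) b b' (by
        rw [hlam, hlam])
    rw [← hb, hlam] at this
    refine minj2 _ (hhU _) (hhU _) ((hlam _).trans this)
  have key' : ∀ q, Q.IsPoly1 q → ∀ b b', h (t.eval Q ![x, b, q v]) = h (t.eval Q ![x, b', q v]) →
      h (t.eval Q ![x, b, q u]) = h (t.eval Q ![x, b', q u]) := by
    intro q hq b b' hb
    have hp : Q.IsPoly {Prod.fst, Prod.snd}
        fun z : Q.carrier × Q.carrier => h (t.eval Q ![x, z.1, q z.2]) :=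
      hh.comp (.eval₃ t (.const x) Q.isPoly2_fst (hq.comp Q.isPoly2_snd))
    have hp' : Q.IsPoly {Prod.fst, Prod.snd}
        fun z : Q.carrier × Q.carrier => h (t.eval Q ![x, b, q z.2]) :=
      hh.comp (.eval₃ t (.const x) (.const b) (hq.comp Q.isPoly2_snd))
    have := hcon (fun a z => m (h (t.eval Q ![x, a, q z])) (lam (h (t.eval Q ![x, b, q z]))))
      (hm.comp hp (hm.iterate hp' (.const u) N)) (fun _ _ => mU _ _) b b' (by
        rw [hlam, hlam])
    rw [← hb, hlam] at this
    refine minj2 _ (hhU _) (hhU _) ((hlam _).trans this.symm)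
  have := (hQ.iff_of_forall huv
    (P := fun w => h (t.eval Q ![x, x, w]) = h (t.eval Q ![x, y, w]))
    (fun q hq => ⟨key q hq x y, key' q hq x y⟩) x y).1
  simp only [h1, h2, h6] at this
  refine hne (this (congrArg h ?_))
  have hc : (![x, x, x] : Fin 3 → Q.carrier) = fun _ => x := by
    funext i
    fin_cases i <;> rfl
  rw [hc, hi.eval_const]

/-- A two-element minimal set `{o, l}` with a meet polynomial whose neutral element is `l`. -/
structure IsMeetPair (Q : UAlgebra σ) (e : Q.carrier → Q.carrier)
    (M : Q.carrier → Q.carrier → Q.carrier) (o l : Q.carrier) : Prop where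
  ne : o ≠ l
  isPoly1 : Q.IsPoly1 e
  eq_or_eq : ∀ x, e x = o ∨ e x = l
  map_o : e o = o
  map_l : e l = l
  isPoly2 : Q.IsPoly2 M
  meet_oo : M o o = o
  meet_ol : M o l = o
  meet_lo : M l o = o
  meet_ll : M l l = l
  sep : ∀ a b, a ≠ b → ∃ h, Q.IsPoly1 h ∧ (∀ x, h x = o ∨ h x = l) ∧ h a ≠ h b

theorem IsMinimalSet.exists_isMeetPair [Finite Q.carrier] (hQ : Q.IsSimple)
    (hU : Q.IsMinimalSet U e) {u v : Q.carrier} (hu : u ∈ U) (hv : v ∈ U) (huv : u ≠ v)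
    {B : Q.carrier → Q.carrier → Q.carrier} (hB : Q.IsPoly2 B) (hBU : ∀ a b, B a b ∈ U)
    (h : ∃ c d, B c u = B c v ∧ B d u ≠ B d v) : ∃ M o l, Q.IsMeetPair e M o l := by
  obtain ⟨k, hk, r, s, hr, hs, hru, hsu⟩ : ∃ k, Q.IsPoly1 k ∧ ∃ r s, r ∈ U ∧ s ∈ U ∧
      B (k r) u = B (k r) v ∧ B (k s) u ≠ B (k s) v := by
    by_contra! hcon
    obtain ⟨c, d, hc, hd⟩ := h
    refine hd ((hQ.iff_of_forall huv (P := fun z => B z u = B z v) (fun k hk => ?_) c d).1 hc)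
    exact ⟨hcon k hk u v hu hv, hcon k hk v u hv hu⟩
  have hrs : r ≠ s := by
    rintro rfl
    exact hsu hru
  let M₀ : Q.carrier → Q.carrier → Q.carrier := fun a b => B (k a) b
  have hM₀ : Q.IsPoly2 M₀ := hB.comp (hk.comp Q.isPoly2_fst) Q.isPoly2_snd
  have hM₀U : ∀ a b, M₀ a b ∈ U := fun _ _ => hBU _ _
  obtain ⟨N, hN, hpow⟩ := exists_iterate_idempotent Q.carrier
  let M : Q.carrier → Q.carrier → Q.carrier := fun a b => (M₀ a)^[N] b
  have hM : Q.IsPoly2 M := hM₀.iterate Q.isPoly2_fst Q.isPoly2_snd N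
  have hMU : ∀ a b, M a b ∈ U := fun a b => by
    obtain ⟨N, rfl⟩ := Nat.exists_eq_succ_of_ne_zero hN.ne'
    simp only [M, Function.iterate_succ_apply']
    exact hM₀U _ _
  have hMM : ∀ a b, M a (M a b) = M a b := fun a b => hpow _ b
  have hMs : ∀ z ∈ U, M s z = z := fun z hz =>
    iterate_eq_self_of_injOn (hpow (M₀ s) z) (hU.injOn hu hv (hM₀.left s) (hM₀U s) hsu)
      (fun b _ => hM₀U s b) hz
  have hMr : ∀ z ∈ U, M r z = M r r := fun z hz => by
    obtain ⟨N, rfl⟩ := Nat.exists_eq_succ_of_ne_zero hN.ne'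
    simp only [M, Function.iterate_succ_apply]
    congr 1
    refine (hU.const_or_injOn (M₀ r) (hM₀.left r) (hM₀U r)).resolve_right (fun hinj => ?_) z hz r hr
    exact huv (hinj hu hv hru)
  generalize hd : M r r = d at hMr
  have hdU : d ∈ U := hd ▸ hMU _ _
  have hinj : ∀ z ∈ U, z ≠ d → Set.InjOn (fun a => M a z) U := fun z hz hzd => by
    refine hU.injOn hr hs (hM.right z) (fun a => hMU a z) ?_
    rw [hMr z hz, hMs z hz]
    exact hzd.symm
  have hUrs : ∀ z ∈ U, z = r ∨ z = s := by
    intro z hz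
    by_cases hzs : z = s
    · exact Or.inr hzs
    obtain ⟨w, hw, hwd⟩ : ∃ w ∈ U, w ≠ d := by
      by_contra! hcon
      exact hrs ((hcon r hr).trans (hcon s hs).symm)
    have hzw : M z w = d := by
      by_contra hne
      refine hzs (hinj _ (hMU z w) hne hz hs ?_)
      simp only [hMM, hMs _ (hMU z w)]
    refine Or.inl (hinj w hw hwd hz hr ?_)
    simp only [hzw, hMr w hw]
  rcases hUrs d hdU with rfl | rfl
  · refine ⟨M, d, s, hrs, hU.isPoly1, fun x => hUrs _ (hU.mem x), hU.eq _ hr, hU.eq _ hs, hM,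
      hMr _ hr, hMr _ hs, hMs _ hr, hMs _ hs, fun a b hab => ?_⟩
    obtain ⟨h, h1, h2, h3⟩ := hU.sep a b hab
    exact ⟨h, h1, fun x => hUrs _ (h2 x), h3⟩
  · refine ⟨fun a b => M (M a b) b, d, r, hrs.symm, hU.isPoly1, fun x => (hUrs _ (hU.mem x)).symm,
      hU.eq _ hs, hU.eq _ hr, hM.comp hM Q.isPoly2_snd, ?_, ?_, ?_, ?_, fun a b hab => ?_⟩
    · simp only [hMs _ hs]
    · simp only [hMs _ hr, hMr _ hr]
    · simp only [hMr _ hs, hMs _ hs]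
    · simp only [hMr _ hr, hMs _ hr]
    obtain ⟨h, h1, h2, h3⟩ := hU.sep a b hab
    exact ⟨h, h1, fun x => (hUrs _ (h2 x)).symm, h3⟩

theorem HasMajority.exists_isMeetPair [Finite Q.carrier] (hQ : Q.IsSimple) (hi : Q.Idempotent)
    {x y : Q.carrier} (hxy : x ≠ y) (hm : Q.HasMajority x y) :
    ∃ e M o l, Q.IsMeetPair e M o l := by
  obtain ⟨U, e, hU⟩ := hQ.exists_isMinimalSet ⟨x, y, hxy⟩
  obtain ⟨h, -, hhU, hne⟩ := hU.sep x y hxy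
  obtain ⟨B, hB, hBU, h'⟩ := hU.exists_isPoly2 hQ hi hxy hm (hhU x) (hhU y) hne
  exact ⟨e, hU.exists_isMeetPair hQ (hhU x) (hhU y) hne hB hBU h'⟩

end UAlgebra

namespace UAlgebra

variable {σ : Signature} {A Q R : UAlgebra σ} {e : Q.carrier → Q.carrier}
  {M J : Q.carrier → Q.carrier → Q.carrier} {o l : Q.carrier}

/-- A lift of the idempotent polynomial `e` along `φ` of least possible range. -/
structure IsMinimalLift (R : UAlgebra σ) {Q : UAlgebra σ} (φ : R.carrier → Q.carrier)
    (e : Q.carrier → Q.carrier) (p : R.carrier → R.carrier) : Prop where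
  isPoly1 : R.IsPoly1 p
  lift : ∀ r, φ (p r) = e (φ r)
  le : ∀ f, R.IsPoly1 f → (∀ r, φ (f r) = e (φ r)) → (Set.range p).ncard ≤ (Set.range f).ncard

theorem exists_isMinimalLift {φ : R.carrier → Q.carrier} (hφ : IsHom R Q φ)
    (hs : Function.Surjective φ) (he : Q.IsPoly1 e) : ∃ p, R.IsMinimalLift φ e p := by
  obtain ⟨p, ⟨hp, hpe⟩, hmin⟩ :=
    (measure fun p : R.carrier → R.carrier => (Set.range p).ncard).wf.has_min
      {p | R.IsPoly1 p ∧ ∀ r, φ (p r) = e (φ r)} (he.exists_lift hφ hs)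
  exact ⟨p, hp, hpe, fun f hf hfe => not_lt.1 (hmin f ⟨hf, hfe⟩)⟩

theorem IsMinimalLift.injOn [Finite R.carrier] {φ : R.carrier → Q.carrier}
    {p : R.carrier → R.carrier} (hp : R.IsMinimalLift φ e p) {f : R.carrier → R.carrier}
    (hf : R.IsPoly1 f) (h : ∀ r, φ (f (p r)) = e (φ r)) : Set.InjOn f (Set.range p) := by
  have := hp.le _ (hf.comp hp.isPoly1) h
  have hr : Set.range (fun z => f (p z)) = f '' Set.range p := by
    rw [← Set.range_comp]
    rfl
  rw [hr] at this
  exact (Set.ncard_image_iff (Set.toFinite _)).1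
    (le_antisymm (Set.ncard_image_le (Set.toFinite _)) this)

/-- The range of a minimal lift has only one point above the neutral element. -/
theorem IsMeetPair.eq_of_lift [Finite R.carrier] (hM : Q.IsMeetPair e M o l)
    {φ : R.carrier → Q.carrier} (hφ : IsHom R Q φ) (hs : Function.Surjective φ)
    {p : R.carrier → R.carrier} (hp : R.IsMinimalLift φ e p) {i j : R.carrier}
    (hi : i ∈ Set.range p) (hj : j ∈ Set.range p) (hi' : φ i = l) (hj' : φ j = l) : i = j := by
  obtain ⟨W₀, hW₀, hW₀M⟩ := hM.isPoly2.exists_lift hφ hs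
  let W : R.carrier → R.carrier → R.carrier := fun a b => p (W₀ a b)
  have hW : R.IsPoly2 W := hp.isPoly1.comp hW₀
  have hWU : ∀ a b, W a b ∈ Set.range p := fun _ _ => ⟨_, rfl⟩
  have hWM : ∀ a b, φ (W a b) = e (M (φ a) (φ b)) := fun a b => by rw [hp.lift, hW₀M]
  obtain ⟨N, hN, hpow⟩ := exists_iterate_idempotent R.carrier
  obtain ⟨N, rfl⟩ := Nat.exists_eq_succ_of_ne_zero hN.ne'
  have hfix : ∀ i b, φ i = l → b ∈ Set.range p → (W i)^[N + 1] b = b := fun i b hi hb => by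
    refine iterate_eq_self_of_injOn (hpow (W i) b) (hp.injOn (hW.left i) fun r => ?_)
      (fun b _ => hWU i b) hb
    rw [hWM, hi, hp.lift]
    rcases hM.eq_or_eq (φ r) with h | h <;> simp [h, hM.meet_lo, hM.meet_ll, hM.map_o, hM.map_l]
  have hinj : Set.InjOn (fun a => (W a)^[N + 1] j) (Set.range p) := by
    have hpoly : R.IsPoly1 fun a => (W a)^[N + 1] j := hW.iterate R.isPoly1_id (.const j) _
    refine hp.injOn hpoly fun r => ?_
    rcases hM.eq_or_eq (φ r) with h | h
    · have key : ∀ n, φ ((W (p r))^[n + 1] j) = o := fun n => by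
        induction n with
        | zero => simp [hWM, hp.lift, h, hj', hM.meet_ol, hM.map_o]
        | succ n ih =>
          rw [Function.iterate_succ_apply', hWM, ih, hp.lift, h, hM.meet_oo, hM.map_o]
      rw [key, h]
    · have key : ∀ n, φ ((W (p r))^[n] j) = l := fun n => by
        induction n with
        | zero => exact hj'
        | succ n ih => simp [Function.iterate_succ_apply', hWM, hp.lift, h, ih,
            hM.meet_ll, hM.map_l]
      rw [key, h]
  exact hinj hi hj ((hfix i j hi' hj).trans (hfix j j hj' hj).symm)

/-- If a simple quotient has a meet and a join polynomial on a minimal set, then it is a quotient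
by a meet-prime congruence. -/
theorem IsMeetPair.prime [Finite R.carrier] (hM : Q.IsMeetPair e M o l)
    (hJ : Q.IsMeetPair e J l o) {φ : R.carrier → Q.carrier} (hφ : IsHom R Q φ)
    (hs : Function.Surjective φ) (α β : Congruence R)
    (h : ∀ r s, α.rel r s → β.rel r s → φ r = φ s) :
    (∀ r s, α.rel r s → φ r = φ s) ∨ ∀ r s, β.rel r s → φ r = φ s := by
  by_contra! hcon
  obtain ⟨p, hp⟩ := exists_isMinimalLift hφ hs hM.isPoly1
  have key : ∀ α : Congruence R, (∃ r s, α.rel r s ∧ φ r ≠ φ s) →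
      ∃ i j, i ∈ Set.range p ∧ j ∈ Set.range p ∧ α.rel i j ∧ φ i = l ∧ φ j = o := by
    rintro α ⟨r, s, hrs, hne⟩
    obtain ⟨g, hg, hgU, hgne⟩ := hM.sep _ _ hne
    obtain ⟨g', hg', hgg'⟩ := hg.exists_lift hφ hs
    have hrel := α.rel_of_isPoly1 (hp.isPoly1.comp hg') hrs
    have hfix : ∀ r, φ (p (g' r)) = g (φ r) := fun r => by
      rw [hp.lift, hgg']
      rcases hgU (φ r) with h | h <;> rw [h]
      exacts [hM.map_o, hM.map_l]
    rcases hgU (φ r) with h | h <;> rcases hgU (φ s) with h' | h'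
    · exact absurd (h.trans h'.symm) hgne
    · exact ⟨_, _, ⟨_, rfl⟩, ⟨_, rfl⟩, α.symm hrel, by rw [hfix, h'], by rw [hfix, h]⟩
    · exact ⟨_, _, ⟨_, rfl⟩, ⟨_, rfl⟩, hrel, by rw [hfix, h], by rw [hfix, h']⟩
    · exact absurd (h.trans h'.symm) hgne
  obtain ⟨i, j, hi, hj, hij, hil, hjo⟩ := key α hcon.1
  obtain ⟨i', j', hi', hj', hij', hil', hjo'⟩ := key β hcon.2
  rw [hM.eq_of_lift hφ hs hp hi' hi hil' hil, hJ.eq_of_lift hφ hs hp hj' hj hjo' hjo] at hij'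
  have := h _ _ hij hij'
  rw [hil, hjo] at this
  exact hM.ne this.symm

theorem IsMeetPair.exists_factor [Finite R.carrier] (hM : Q.IsMeetPair e M o l)
    (hJ : Q.IsMeetPair e J l o) {φ : R.carrier → Q.carrier} (hφ : IsHom R Q φ)
    (hs : Function.Surjective φ) {ι : Type} [Finite ι] {A : ι → UAlgebra σ}
    {p : ∀ i, R.carrier → (A i).carrier} (hp : ∀ i, IsHom R (A i) (p i))
    (inj : ∀ r s, (∀ i, p i r = p i s) → r = s) :
    ∃ i, ∀ r s, p i r = p i s → φ r = φ s := by
  classical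
  have := Fintype.ofFinite ι
  have key : ∀ s : Finset ι, (∀ r t, (∀ i ∈ s, p i r = p i t) → φ r = φ t) →
      ∃ i, ∀ r t, p i r = p i t → φ r = φ t := by
    intro s
    induction s using Finset.induction_on with
    | empty =>
      intro h
      obtain ⟨r, hr⟩ := hs o
      obtain ⟨t, ht⟩ := hs l
      have := h r t (by simp)
      rw [hr, ht] at this
      exact absurd this hM.ne
    | insert j s _ ih =>
      intro h
      have hps : IsHom R (pi fun i : s => A i) fun r i => p i r := fun f x =>
        funext fun i => hp i f x
      rcases hM.prime hJ hφ hs (hp j).ker hps.ker fun r t hj hrt => h r t fun i hi => by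
        rcases Finset.mem_insert.1 hi with rfl | hi
        · exact hj
        · exact congrFun hrt ⟨i, hi⟩ with h' | h'
      · exact ⟨j, h'⟩
      · exact ih fun r t hrt => h' r t (funext fun i => hrt i.1 i.2)
  exact key Finset.univ fun r s h => congrArg φ (inj r s fun i => h i (Finset.mem_univ i))

theorem IsSmooth.eq_or_eq (hA : A.IsSmooth) {a b : A.carrier}
    {ψ : (A.Sg {a, b}).carrier → Q.carrier}
    (hψ : IsHom _ Q ψ) (sψ : Function.Surjective ψ) (hQ : Q.IsSimple)
    (hne : ψ (A.sgA a b) ≠ ψ (A.sgB a b))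
    (h : Q.HasMajority (ψ (A.sgA a b)) (ψ (A.sgB a b)))
    (h' : ¬ Q.HasSemilattice (ψ (A.sgA a b)) (ψ (A.sgB a b))) (z : Q.carrier) :
    z = ψ (A.sgA a b) ∨ z = ψ (A.sgB a b) := by
  have hw : A.MajWitness a b hψ.ker := by
    obtain ⟨⟨α, hα, sα, e⟩, β, hβ, -, e'⟩ := exists_quot_homs hψ sψ hψ.ker fun _ _ => Iff.rfl
    have := IsOfType.map (τ := .majority) ⟨h, h'⟩ hα sα hβ (by rw [e, e']) (by rw [e, e'])
    rw [e, e] at this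
    exact ⟨(hψ.isMaximal_iff sψ _ fun _ _ => Iff.rfl).2 ⟨hQ, _, _, hne⟩, this.1, this.2⟩
  have hcl := hA a b _ (Or.inr hw)
  obtain ⟨r, rfl⟩ := sψ z
  have hsub : A.ClosureSet {a, b} ⊆ A.edgeBlockUnion a b hψ.ker := by
    refine closureSet_subset hcl ?_
    rintro c (rfl | rfl)
    · exact ⟨(A.sgA c b).2, Or.inl rfl⟩
    · exact ⟨(A.sgB a c).2, Or.inr rfl⟩
  obtain ⟨_, hr⟩ := hsub r.2
  exact hr

/-- If a quotient of a two-generated algebra factors through a homomorphism to a smooth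
restricted algebra, then its majority type is one of the admitted types. -/
theorem Restricted.majority_mem [Finite A.carrier] (hA : A.Idempotent) (hsm : A.IsSmooth)
    {T : Set EdgeType} (hres : A.Restricted T) (hT : EdgeType.unary ∉ T)
    {u v : R.carrier} (hR : R.ClosureSet {u, v} = Set.univ)
    {p : R.carrier → A.carrier} (hp : IsHom R A p) {φ : R.carrier → Q.carrier}
    (hφ : IsHom R Q φ) (hs : Function.Surjective φ) (hQ : Q.IsSimple)
    (h : ∀ r s, p r = p s → φ r = φ s) (huv : φ u ≠ φ v) (hm : Q.HasMajority (φ u) (φ v))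
    (hsl : ¬ Q.HasSemilattice (φ u) (φ v)) : EdgeType.majority ∈ T := by
  have hmem : ∀ r, p r ∈ A.ClosureSet {p u, p v} := fun r => by
    have hr : r ∈ R.ClosureSet {u, v} := hR ▸ trivial
    refine closureSet_subset (hp.isClosed_preimage (A.closureSet_isClosed _)) ?_ hr
    rintro c (rfl | rfl)
    · exact (A.sgA _ _).2
    · exact (A.sgB _ _).2
  let π : R.carrier → (A.Sg {p u, p v}).carrier := fun r => ⟨p r, hmem r⟩
  have hπ : IsHom R (A.Sg {p u, p v}) π := fun f x => Subtype.ext (hp f x)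
  have sπ : Function.Surjective π := by
    refine hπ.surjective_of_closure (A.closureSet_sg _ _) ?_
    rintro c (rfl | rfl)
    · exact ⟨u, rfl⟩
    · exact ⟨v, rfl⟩
  obtain ⟨ψ, hψ, sψ, e⟩ := exists_isHom_factor hπ hφ sπ hs fun r s hrs =>
    h r s (congrArg Subtype.val hrs)
  have eu : ψ (A.sgA (p u) (p v)) = φ u := e u
  have ev : ψ (A.sgB (p u) (p v)) = φ v := e v
  have two := hsm.eq_or_eq hψ sψ hQ (by rwa [eu, ev]) (by rwa [eu, ev]) (by rwa [eu, ev])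
  rw [eu, ev] at two
  have hpair : ∀ z w : Q.carrier, z ≠ w → z = φ u ∧ w = φ v ∨ z = φ v ∧ w = φ u := by
    intro z w hzw
    rcases two z with rfl | rfl <;> rcases two w with rfl | rfl <;> simp_all
  have hQs : Q.IsStrictlySimple := fun S _ z hz w hw hzw => by
    refine Set.eq_univ_of_forall fun c => ?_
    rcases hpair z w hzw with ⟨rfl, rfl⟩ | ⟨rfl, rfl⟩ <;> rcases two c with rfl | rfl <;> assumption
  obtain ⟨τ, hτ, z, w, hzw, ht⟩ := hres.exists_isOfType hA hψ sψ hQs ⟨_, _, huv⟩ fun z w hzw => by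
    rcases hpair z w hzw with ⟨rfl, rfl⟩ | ⟨rfl, rfl⟩
    · exact Or.inr (Or.inr (Or.inr hm))
    · exact Or.inr (Or.inr (Or.inr hm.symm))
  cases τ with
  | unary => exact absurd hτ hT
  | majority => exact hτ
  | affine => exact absurd hm (IsAffineAlgebra.not_hasMajority ht huv)
  | semilattice =>
    rcases hpair z w hzw with ⟨rfl, rfl⟩ | ⟨rfl, rfl⟩
    · exact absurd ht hsl
    · exact absurd (HasSemilattice.symm ht) hsl

end UAlgebra

namespace Term

variable {σ : Signature} {n : ℕ}

/-- Substitute `s (x i) y` for the variable `x i`, where `y` is a new variable. -/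
def graft (t : Term σ n) (i : Fin n) (s : Term σ 2) : Term σ (n + 1) :=
  t.subst fun j => if j = i then s.subst₂ (.var i.castSucc) (.var (Fin.last n))
    else .var j.castSucc

theorem eval_graft (A : UAlgebra σ) (t : Term σ n) (i : Fin n) (s : Term σ 2)
    (z : Fin (n + 1) → A.carrier) :
    (t.graft i s).eval A z = t.eval A (Function.update (fun j => z j.castSucc) i
      (s.eval A ![z i.castSucc, z (Fin.last n)])) := by
  rw [graft, eval_subst]
  congr 1
  funext j
  by_cases h : j = i
  · subst h
    simp [eval_subst₂, eval]
  · simp [h, eval]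

end Term

namespace UAlgebra

variable {σ : Signature} {Q : UAlgebra σ} {le : Q.carrier → Q.carrier → Prop}
  {H : Set (Q.carrier → Prop)} {n : ℕ} {c q : Q.carrier} {h : Q.carrier → Prop}

theorem eval_graft_castSucc (hQ : Q.Idempotent) (t : Term σ n) (i : Fin n) (s : Term σ 2)
    {j : Fin n} (hj : j ≠ i) (c q : Q.carrier) :
    (t.graft i s).eval Q (Function.update (fun _ => c) j.castSucc q) =
      t.eval Q (Function.update (fun _ => c) j q) := by
  rw [Term.eval_graft]
  congr 1
  funext k
  by_cases hk : k = i
  · subst hk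
    simp [hj.symm, (Fin.castSucc_lt_last j).ne', hQ.eval_pair]
  · simp [hk, Function.update_apply]

theorem eval_graft_castSucc_self (t : Term σ n) (i : Fin n) (s : Term σ 2) (c q : Q.carrier) :
    (t.graft i s).eval Q (Function.update (fun _ => c) i.castSucc q) =
      t.eval Q (Function.update (fun _ => c) i (s.eval Q ![q, c])) := by
  rw [Term.eval_graft]
  congr 1
  funext k
  by_cases hk : k = i
  · subst hk
    simp [(Fin.castSucc_lt_last k).ne']
  · simp [hk, Function.update_apply]

theorem eval_graft_last (t : Term σ n) (i : Fin n) (s : Term σ 2) (c q : Q.carrier) :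
    (t.graft i s).eval Q (Function.update (fun _ => c) (Fin.last n) q) =
      t.eval Q (Function.update (fun _ => c) i (s.eval Q ![c, q])) := by
  rw [Term.eval_graft]
  congr 1
  funext k
  by_cases hk : k = i
  · subst hk
    simp [(Fin.castSucc_lt_last k).ne]
  · simp [hk]

/-- A compatible order together with a family of up-sets closed under pulling back along
translations, on which every operation behaves like a meet. -/
structure IsMeetSystem (Q : UAlgebra σ) (le : Q.carrier → Q.carrier → Prop)
    (H : Set (Q.carrier → Prop)) : Prop where
  refl : ∀ a, le a a
  trans : ∀ {a b c}, le a b → le b c → le a c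
  le_eval : ∀ {n} (t : Term σ n) {r w : Fin n → Q.carrier}, (∀ j, le (r j) (w j)) →
    le (t.eval Q r) (t.eval Q w)
  mono : ∀ {h}, h ∈ H → ∀ {a b}, le a b → h a → h b
  comp_mem : ∀ {h}, h ∈ H → ∀ {n} (t : Term σ n) (w : Fin n → Q.carrier) (i : Fin n),
    (fun z => h (t.eval Q (Function.update w i z))) ∈ H
  inter : ∀ {h}, h ∈ H → ∀ {n} (t : Term σ n) (w : Fin n → Q.carrier) {i j : Fin n}, i ≠ j →
    ∀ {a b}, le a (w i) → le b (w j) → h (t.eval Q (Function.update w i a)) →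
    h (t.eval Q (Function.update w j b)) →
    h (t.eval Q (Function.update (Function.update w i a) j b))
  sep : ∀ {a b}, (∀ h ∈ H, h a ↔ h b) → a = b
  connected : ∀ P : Q.carrier → Prop, (∀ {a b}, le a b → (P a ↔ P b)) → ∀ a b, P a → P b

/-- The triples `(c, q, h)` where `h` separates `q` from a larger element `c`. -/
def Drop (le : Q.carrier → Q.carrier → Prop) (H : Set (Q.carrier → Prop)) :
    Set (Q.carrier × Q.carrier × (Q.carrier → Prop)) :=
  {ω | le ω.2.1 ω.1 ∧ ω.2.2 ∈ H ∧ ω.2.2 ω.1 ∧ ¬ ω.2.2 ω.2.1}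

open Classical in
/-- The variables of `t` whose drop from `c` to `q` is detected by `h`. -/
noncomputable def dropVars (t : Term σ n)
    (ω : Q.carrier × Q.carrier × (Q.carrier → Prop)) : Finset (Fin n) :=
  {i | ¬ ω.2.2 (t.eval Q (Function.update (fun _ => ω.1) i ω.2.1))}

theorem mem_dropVars {t : Term σ n} {ω : Q.carrier × Q.carrier × (Q.carrier → Prop)}
    {i : Fin n} : i ∈ dropVars t ω ↔
      ¬ ω.2.2 (t.eval Q (Function.update (fun _ => ω.1) i ω.2.1)) := by
  simp [dropVars]

namespace IsMeetSystem

theorem of_forall_update (hS : Q.IsMeetSystem le H) (hh : h ∈ H) (t : Term σ n)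
    {r w : Fin n → Q.carrier} (hr : ∀ j, le (r j) (w j)) (hw : h (t.eval Q w))
    (hi : ∀ i, h (t.eval Q (Function.update w i (r i)))) : h (t.eval Q r) := by
  have key : ∀ (s : Finset (Fin n)) (w : Fin n → Q.carrier), (∀ j, le (r j) (w j)) →
      h (t.eval Q w) → (∀ i ∈ s, h (t.eval Q (Function.update w i (r i)))) →
      h (t.eval Q (s.piecewise r w)) := by
    intro s
    induction s using Finset.induction_on with
    | empty =>
      intro w _ hw _
      simpa using hw
    | insert i s hi ih =>
      intro w hr hw hs
      have := ih (Function.update w i (r i)) (fun j => by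
        by_cases hj : j = i
        · subst hj
          simpa using hS.refl _
        · simpa [hj] using hr j) (hs i (Finset.mem_insert_self _ _)) fun j hj =>
        hS.inter hh t w (i := i) (j := j) (fun hij => hi (hij ▸ hj)) (hr i) (hr j)
          (hs i (Finset.mem_insert_self _ _)) (hs j (Finset.mem_insert_of_mem hj))
      convert this using 2
      funext k
      by_cases hk : k = i
      · subst hk
        simp [hi]
      · by_cases hks : k ∈ s <;> simp [hk, hks]
  simpa using key Finset.univ w hr hw fun i _ => hi i

theorem of_forall_update_const (hS : Q.IsMeetSystem le H) (hQ : Q.Idempotent) (hh : h ∈ H)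
    (hc : h c) (t : Term σ n) {r : Fin n → Q.carrier} (hr : ∀ j, le (r j) c)
    (hi : ∀ i, h (t.eval Q (Function.update (fun _ => c) i (r i)))) : h (t.eval Q r) :=
  hS.of_forall_update hh t hr (by rwa [hQ.eval_const]) hi

theorem of_pair (hS : Q.IsMeetSystem le H) (hQ : Q.Idempotent) (hh : h ∈ H)
    (hc : h c) (hqc : le q c) (s : Term σ 2) (h1 : h (s.eval Q ![c, q]))
    (h2 : h (s.eval Q ![q, c])) : h q := by
  rw [← hQ.eval_pair s q]
  refine hS.of_forall_update_const hQ hh hc s (Fin.forall_fin_two.2 ⟨hqc, hqc⟩)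
    (Fin.forall_fin_two.2 ⟨?_, ?_⟩)
  · convert h2 using 2
    funext i
    fin_cases i <;> rfl
  · convert h1 using 2
    funext i
    fin_cases i <;> rfl

theorem dropVars_nonempty (hS : Q.IsMeetSystem le H) (hQ : Q.Idempotent) (t : Term σ n)
    {ω : Q.carrier × Q.carrier × (Q.carrier → Prop)} (hω : ω ∈ Drop le H) :
    (dropVars t ω).Nonempty := by
  by_contra hcon
  obtain ⟨hle, hh, hc, hq⟩ := hω
  refine hq ?_
  rw [← hQ.eval_const t ω.2.1]
  refine hS.of_forall_update_const hQ hh hc t (fun _ => hle) fun i => ?_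
  by_contra hi
  exact hcon ⟨i, mem_dropVars.2 hi⟩

theorem exists_split (hS : Q.IsMeetSystem le H) (hQ : Q.Idempotent)
    (hset : ¬ ∀ f : σ.ops, ∃ i, ∀ r : Fin (σ.arity f) → Q.carrier,
      (∀ j, r j ∈ Q.ClosureSet {c, q}) → (h (Q.interp f r) ↔ h (r i)))
    (hω : (c, q, h) ∈ Drop le H) :
    ∃ s : Term σ 2, ¬ h (s.eval Q ![c, q]) ∧ ¬ h (s.eval Q ![q, c]) := by
  by_contra! hcon
  obtain ⟨hqc, hh, hc, hq⟩ := hω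
  dsimp only at hqc hh hc hq
  have pair : ∀ {n} (t : Term σ n) {i j : Fin n}, i ≠ j →
      ¬ h (t.eval Q (Function.update (fun _ => c) i q)) →
      h (t.eval Q (Function.update (fun _ => c) j q)) := by
    intro n t i j hij hi
    have h1 : ∀ a b, (t.subst fun k => if k = i then .var 1 else .var 0 : Term σ 2).eval Q ![a, b]
        = t.eval Q (Function.update (fun _ => a) i b) := fun a b => by
      rw [Term.eval_subst]
      congr 1
      funext k
      by_cases hk : k = i <;> simp [hk, Term.eval]
    have := hcon (t.subst fun k => if k = i then .var 1 else .var 0) (by rwa [h1])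
    rw [h1] at this
    refine hS.mono hh (hS.le_eval t fun k => ?_) this
    by_cases hki : k = i
    · subst hki
      simpa [hij] using hS.refl c
    · by_cases hkj : k = j
      · subst hkj
        simpa [hki] using hS.refl q
      · simpa [hki, hkj] using hqc
  refine hset fun f => ?_
  let t : Term σ (σ.arity f) := .app f .var
  obtain ⟨p, hp⟩ := hS.dropVars_nonempty hQ t (ω := (c, q, h)) ⟨hqc, hh, hc, hq⟩
  rw [mem_dropVars] at hp
  have hle : ∀ v ∈ Q.ClosureSet {c, q}, le v c := fun v hv => by
    obtain ⟨s, rfl⟩ := exists_term_of_mem_closure hv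
    rw [← hQ.eval_pair s c]
    exact hS.le_eval s (Fin.forall_fin_two.2 ⟨by simpa [hQ.eval_pair] using hS.refl c,
      by simpa [hQ.eval_pair] using hqc⟩)
  have off : ∀ v ∈ Q.ClosureSet {c, q}, ∀ i, i ≠ p →
      h (t.eval Q (Function.update (fun _ => c) i v)) := fun v hv i hi => by
    obtain ⟨s, rfl⟩ := exists_term_of_mem_closure hv
    rw [← eval_graft_last]
    refine pair _ (i := p.castSucc) (Fin.castSucc_lt_last p).ne ?_
    rwa [eval_graft_castSucc hQ t i s hi.symm]
  have on : ∀ v ∈ Q.ClosureSet {c, q}, h (t.eval Q (Function.update (fun _ => c) p v)) → h v :=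
    fun v hv h' => by
      rw [← hQ.eval_const t v]
      refine hS.of_forall_update_const hQ hh hc t (fun _ => hle v hv) fun i => ?_
      by_cases hi : i = p
      · rwa [hi]
      · exact off v hv i hi
  have on' : ∀ v ∈ Q.ClosureSet {c, q}, h v → h (t.eval Q (Function.update (fun _ => c) p v)) :=
    fun v hv h' => by
      obtain ⟨s, rfl⟩ := exists_term_of_mem_closure hv
      rw [← eval_graft_last]
      refine pair _ (i := p.castSucc) (Fin.castSucc_lt_last p).ne ?_
      rw [eval_graft_castSucc_self]
      refine fun h2 => hq (hS.of_pair hQ hh hc hqc s h' (on _ ?_ h2))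
      refine (Q.closureSet_isClosed _).eval_mem s _ (Fin.forall_fin_two.2 ⟨?_, ?_⟩)
      · exact Q.subset_closureSet _ (Or.inr rfl)
      · exact Q.subset_closureSet _ (Or.inl rfl)
  refine ⟨p, fun r hr => ⟨fun h' => on _ (hr p) (hS.mono hh (hS.le_eval t fun j => ?_) h'),
    fun h' => hS.of_forall_update_const hQ hh hc t (fun j => hle _ (hr j)) fun i => ?_⟩⟩
  · by_cases hj : j = p
    · subst hj
      simpa using hS.refl _
    · simpa [hj] using hle _ (hr j)
  · by_cases hi : i = p
    · subst hi
      exact on' _ (hr i) h'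
    · exact off _ (hr i) i hi

end IsMeetSystem

end UAlgebra

namespace UAlgebra

variable {σ : Signature} {Q : UAlgebra σ} {le : Q.carrier → Q.carrier → Prop}
  {H : Set (Q.carrier → Prop)} {n : ℕ}

theorem card_dropVars_graft_lt (hQ : Q.Idempotent) (t : Term σ n)
    (i : Fin n) (s : Term σ 2) {ω : Q.carrier × Q.carrier × (Q.carrier → Prop)}
    (h1 : ¬ ω.2.2 (t.eval Q (Function.update (fun _ => ω.1) i (s.eval Q ![ω.1, ω.2.1]))))
    (h2 : ¬ ω.2.2 (t.eval Q (Function.update (fun _ => ω.1) i (s.eval Q ![ω.2.1, ω.1])))) :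
    (dropVars t ω).card < (dropVars (t.graft i s) ω).card := by
  refine lt_of_lt_of_le (Nat.lt_succ_self _) ?_
  rw [Nat.succ_eq_add_one, ← Finset.card_map Fin.castSuccEmb,
    ← Finset.card_cons (a := Fin.last n) (h := by simp [(Fin.castSucc_lt_last _).ne])]
  refine Finset.card_le_card fun k hk => ?_
  rcases Finset.mem_cons.1 hk with rfl | hk
  · rwa [mem_dropVars, eval_graft_last]
  · obtain ⟨j, hj, rfl⟩ := Finset.mem_map.1 hk
    rw [mem_dropVars] at hj ⊢
    by_cases hji : j = i
    · subst hji
      exact fun h => h2 (eval_graft_castSucc_self t j s _ _ ▸ h)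
    · exact fun h => hj (eval_graft_castSucc hQ t i s hji _ _ ▸ h)

/-- No subalgebra generated by a drop is split by an element of `H` into a two-element set. -/
def NoSet (Q : UAlgebra σ) (le : Q.carrier → Q.carrier → Prop) (H : Set (Q.carrier → Prop)) :
    Prop :=
  ∀ c q h, (c, q, h) ∈ Drop le H → ¬ ∀ f : σ.ops, ∃ i, ∀ r : Fin (σ.arity f) → Q.carrier,
    (∀ j, r j ∈ Q.ClosureSet {c, q}) → (h (Q.interp f r) ↔ h (r i))

namespace IsMeetSystem

theorem card_dropVars_graft (hS : Q.IsMeetSystem le H) (hQ : Q.Idempotent) (t : Term σ n)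
    (i : Fin n) (s : Term σ 2) {ω : Q.carrier × Q.carrier × (Q.carrier → Prop)}
    (hω : ω ∈ Drop le H) : (dropVars t ω).card ≤ (dropVars (t.graft i s) ω).card := by
  obtain ⟨j, hj⟩ : ∃ j : Fin (n + 1), (∀ k, k ≠ i → k.castSucc ≠ j) ∧
      (i ∈ dropVars t ω → j ∈ dropVars (t.graft i s) ω) := by
    by_cases hi : i ∈ dropVars t ω
    · by_cases hc : i.castSucc ∈ dropVars (t.graft i s) ω
      · exact ⟨i.castSucc, fun k hk hki => hk (Fin.castSucc_injective n hki), fun _ => hc⟩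
      · refine ⟨Fin.last n, fun k _ => (Fin.castSucc_lt_last k).ne, fun _ => ?_⟩
        rw [mem_dropVars] at hi hc ⊢
        rw [eval_graft_castSucc_self, not_not] at hc
        rw [eval_graft_last]
        obtain ⟨hle, hh, hcc, -⟩ := hω
        exact fun hl => hi (hS.of_pair
          (h := fun z => ω.2.2 (t.eval Q (Function.update (fun _ => ω.1) i z))) hQ
          (hS.comp_mem hh t (fun _ => ω.1) i)
          (by simpa [hQ.eval_const] using hcc) hle s hl hc)
    · exact ⟨Fin.last n, fun k _ => (Fin.castSucc_lt_last k).ne, fun h => absurd h hi⟩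
  refine Finset.card_le_card_of_injOn (fun k => if k = i then j else k.castSucc) ?_ ?_
  · intro k hk
    by_cases hki : k = i
    · subst hki
      simpa using hj.2 hk
    · simp only [hki, if_false, Finset.mem_coe]
      rw [Finset.mem_coe, mem_dropVars] at hk
      rwa [mem_dropVars, eval_graft_castSucc hQ t i s hki]
  · intro k _ k' _ hkk'
    by_cases hki : k = i <;> by_cases hki' : k' = i <;> simp only [hki, hki', if_true, if_false]
      at hkk' ⊢
    · exact absurd hkk'.symm (hj.1 k' hki')
    · exact absurd hkk' (hj.1 k hki)
    · exact Fin.castSucc_injective n hkk'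

theorem exists_card_le_dropVars [Finite Q.carrier] (hS : Q.IsMeetSystem le H)
    (hQ : Q.Idempotent) (hset : NoSet Q le H) (N : ℕ) :
    ∃ (n : ℕ) (t : Term σ n), ∀ ω ∈ Drop le H, N ≤ (dropVars t ω).card := by
  classical
  induction N with
  | zero => exact ⟨1, .var 0, fun _ _ => Nat.zero_le _⟩
  | succ N ih =>
    have key : ∀ F : Finset (Q.carrier × Q.carrier × (Q.carrier → Prop)),
        ∃ (n : ℕ) (t : Term σ n), (∀ ω ∈ Drop le H, N ≤ (dropVars t ω).card) ∧
          ∀ ω ∈ F, ω ∈ Drop le H → N + 1 ≤ (dropVars t ω).card := by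
      intro F
      induction F using Finset.induction_on with
      | empty =>
        obtain ⟨n, t, ht⟩ := ih
        exact ⟨n, t, ht, by simp⟩
      | insert ω F _ ihF =>
        obtain ⟨n, t, ht, htF⟩ := ihF
        by_cases hω : ω ∈ Drop le H
        · obtain ⟨i, hi⟩ := hS.dropVars_nonempty hQ t hω
          rw [mem_dropVars] at hi
          have hpull : (ω.1, ω.2.1, fun z =>
              ω.2.2 (t.eval Q (Function.update (fun _ => ω.1) i z))) ∈
              Drop le H :=
            ⟨hω.1, hS.comp_mem hω.2.1 t _ i, by simpa [hQ.eval_const] using hω.2.2.1, hi⟩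
          obtain ⟨s, h1, h2⟩ := hS.exists_split hQ (hset _ _ _ hpull) hpull
          refine ⟨n + 1, t.graft i s, fun ω hω => (ht ω hω).trans
            (hS.card_dropVars_graft hQ t i s hω), fun ω' hF hω' => ?_⟩
          rcases Finset.mem_insert.1 hF with rfl | hF
          · exact lt_of_le_of_lt (ht _ hω') (card_dropVars_graft_lt hQ t i s (ω := ω') h1 h2)
          · exact (htF ω' hF hω').trans (hS.card_dropVars_graft hQ t i s hω')
        · refine ⟨n, t, ht, fun ω' hF hω' => ?_⟩
          rcases Finset.mem_insert.1 hF with rfl | hF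
          · exact absurd hω' hω
          · exact htF ω' hF hω'
    have := Fintype.ofFinite (Q.carrier × Q.carrier × (Q.carrier → Prop))
    obtain ⟨n, t, -, ht⟩ := key Finset.univ
    exact ⟨n, t, fun ω hω => ht ω (Finset.mem_univ _) hω⟩

/-- Some binary term takes the smaller of any two comparable elements. -/
theorem exists_eval_eq [Finite Q.carrier] (hS : Q.IsMeetSystem le H)
    (hQ : Q.Idempotent) (hset : NoSet Q le H) :
    ∃ s : Term σ 2, ∀ q c, le q c → s.eval Q ![q, c] = q ∧ s.eval Q ![c, q] = q := by
  classical
  have := Fintype.ofFinite (Drop le H)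
  obtain ⟨n, t, ht⟩ := hS.exists_card_le_dropVars hQ hset (Fintype.card (Drop le H × Bool))
  obtain ⟨f, hf, hft⟩ := (Finset.all_card_le_biUnion_card_iff_exists_injective
    fun z : Drop le H × Bool => dropVars t z.1.1).1 fun F => by
      rcases F.eq_empty_or_nonempty with rfl | ⟨z, hz⟩
      · simp
      · exact (Finset.card_le_univ F).trans ((ht _ z.1.2).trans (Finset.card_le_card
          (Finset.subset_biUnion_of_mem (fun z : Drop le H × Bool => dropVars t z.1.1) hz)))
  have main : ∀ (b : Bool) (r : Fin n → Q.carrier) (q c : Q.carrier), le q c →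
      (∀ i, r i = q ∨ r i = c) → (∀ ω, r (f (ω, b)) = q) → t.eval Q r = q := by
    intro b r q c hqc hr hrq
    have hrc : ∀ i, le (r i) c := fun i => by
      rcases hr i with h | h <;> rw [h]
      exacts [hqc, hS.refl c]
    refine hS.sep fun h hh => ⟨fun h1 => ?_, fun h1 => ?_⟩
    · by_contra hq
      have hc : h c := by
        rw [← hQ.eval_const t c]
        exact hS.mono hh (hS.le_eval t hrc) h1
      have hω : (c, q, h) ∈ Drop le H := ⟨hqc, hh, hc, hq⟩
      refine mem_dropVars.1 (hft (⟨_, hω⟩, b)) (hS.mono hh (hS.le_eval t fun i => ?_) h1)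
      by_cases hi : i = f (⟨_, hω⟩, b)
      · rw [hi, Function.update_self, hrq]
        exact hS.refl q
      · rw [Function.update_of_ne hi]
        exact hrc i
    · rw [← hQ.eval_const t q] at h1
      refine hS.mono hh (hS.le_eval t fun i => ?_) h1
      rcases hr i with h | h <;> rw [h]
      exacts [hS.refl q, hqc]
  let s : Term σ 2 := t.subst fun i => if ∃ ω, f (ω, true) = i then .var 1 else .var 0
  have hs : ∀ a b, s.eval Q ![a, b] =
      t.eval Q fun i => if ∃ ω, f (ω, true) = i then b else a := fun a b => by
    rw [Term.eval_subst]
    congr 1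
    funext i
    split_ifs <;> rfl
  refine ⟨s, fun q c hqc => ⟨?_, ?_⟩⟩
  · rw [hs]
    refine main false _ q c hqc (fun i => ?_) fun ω => if_neg ?_
    · split_ifs
      exacts [Or.inr rfl, Or.inl rfl]
    · rintro ⟨ω', h⟩
      simpa using hf h
  · rw [hs]
    refine main true _ q c hqc (fun i => ?_) fun ω => if_pos ⟨ω, rfl⟩
    split_ifs
    exacts [Or.inl rfl, Or.inr rfl]

theorem exists_least [Finite Q.carrier] [Nonempty Q.carrier] (hS : Q.IsMeetSystem le H)
    {s : Term σ 2} (hs : ∀ q c, le q c → s.eval Q ![q, c] = q ∧ s.eval Q ![c, q] = q) :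
    ∃ z, ∀ q, le z q := by
  have lower : ∀ {a b p}, le a p → le b p → ∃ d, le d a ∧ le d b := fun {a b p} ha hb => by
    refine ⟨s.eval Q ![a, b], ?_, ?_⟩
    · conv_rhs => rw [← (hs a p ha).1]
      exact hS.le_eval s (Fin.forall_fin_two.2 ⟨hS.refl a, hb⟩)
    · conv_rhs => rw [← (hs b p hb).2]
      exact hS.le_eval s (Fin.forall_fin_two.2 ⟨ha, hS.refl b⟩)
  have dir : ∀ a b, ∃ d, le d a ∧ le d b := fun a b => by
    refine hS.connected (fun b => ∃ d, le d a ∧ le d b) (fun {b c} hbc => ⟨?_, ?_⟩) a b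
      ⟨a, hS.refl a, hS.refl a⟩
    · rintro ⟨d, h1, h2⟩
      exact ⟨d, h1, hS.trans h2 hbc⟩
    · rintro ⟨d, h1, h2⟩
      obtain ⟨d', h3, h4⟩ := lower h2 hbc
      exact ⟨d', hS.trans h3 h1, h4⟩
  have : IsTrans Q.carrier (fun a b => le b a) := ⟨fun _ _ _ h h' => hS.trans h' h⟩
  have hd : Directed (fun a b => le b a) (id : Q.carrier → Q.carrier) := dir
  exact hd.finite_le id

theorem hasSemilattice [Finite Q.carrier] (hS : Q.IsMeetSystem le H)
    (hQ : Q.Idempotent) (hset : NoSet Q le H) {x y : Q.carrier}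
    (hxy : Q.ClosureSet {x, y} = Set.univ) : Q.HasSemilattice x y := by
  obtain ⟨s, hs⟩ := hS.exists_eval_eq hQ hset
  have : Nonempty Q.carrier := ⟨x⟩
  obtain ⟨z, hz⟩ := hS.exists_least hs
  obtain ⟨t, ht⟩ := exists_term_of_mem_closure (a := x) (b := y) (r := z) (hxy ▸ trivial)
  have hl : ∀ a, s.eval Q ![z, a] = z := fun a => (hs z a (hz a)).1
  have hr : ∀ a, s.eval Q ![a, z] = z := fun a => (hs z a (hz a)).2
  refine (hasSemilattice_iff hQ).2 ⟨s.subst₂ s (s.subst₂ t (t.subst₂ (.var 1) (.var 0))), z, ?_⟩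
  simp [Term.eval_subst₂, Term.eval, ht, hl, hr]

end IsMeetSystem

end UAlgebra

namespace UAlgebra

variable {σ : Signature} {Q : UAlgebra σ} {e : Q.carrier → Q.carrier}
  {M : Q.carrier → Q.carrier → Q.carrier} {o l : Q.carrier}

theorem isPoly1_eval_update {n : ℕ} (t : Term σ n) (w : Fin n → Q.carrier) (i : Fin n) :
    Q.IsPoly1 fun z => t.eval Q (Function.update w i z) := by
  refine IsPoly.eval t (g := fun j z => Function.update w i z j) fun j => ?_
  by_cases hj : j = i
  · subst hj
    simp only [Function.update_self]
    exact Q.isPoly1_id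
  · simpa [hj] using IsPoly.const _

theorem isPoly2_eval_update {n : ℕ} (t : Term σ n) (w : Fin n → Q.carrier) (i j : Fin n) :
    Q.IsPoly2 fun a b => t.eval Q (Function.update (Function.update w i a) j b) := by
  refine IsPoly.eval t (g := fun k (z : Q.carrier × Q.carrier) =>
    Function.update (Function.update w i z.1) j z.2 k) fun k => ?_
  by_cases hj : k = j
  · subst hj
    simp only [Function.update_self]
    exact Q.isPoly2_snd
  by_cases hi : k = i
  · subst hi
    simp only [hj, ne_eq, not_false_eq_true, Function.update_of_ne, Function.update_self]
    exact Q.isPoly2_fst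
  · simpa [hj, hi] using IsPoly.const _

/-- The preorder generated by the polynomial images of the pair `(o, l)`. -/
def PolyLE (Q : UAlgebra σ) (o l : Q.carrier) : Q.carrier → Q.carrier → Prop :=
  Relation.ReflTransGen fun a b => ∃ k, Q.IsPoly1 k ∧ k o = a ∧ k l = b

/-- The preimages of `l` under the unary polynomials with values in `{o, l}`. -/
def PolyUpSets (Q : UAlgebra σ) (o l : Q.carrier) : Set (Q.carrier → Prop) :=
  {h | ∃ f, Q.IsPoly1 f ∧ (∀ x, f x = o ∨ f x = l) ∧ h = fun z => f z = l}

theorem PolyLE.map {f : Q.carrier → Q.carrier} (hf : Q.IsPoly1 f) {a b : Q.carrier}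
    (h : Q.PolyLE o l a b) : Q.PolyLE o l (f a) (f b) :=
  Relation.ReflTransGen.lift f (r := fun a b => ∃ k, Q.IsPoly1 k ∧ k o = a ∧ k l = b)
    (fun _ _ ⟨k, hk, ha, hb⟩ => ⟨fun z => f (k z), hf.comp hk, congrArg f ha, congrArg f hb⟩) _ _ h

namespace IsMeetPair

theorem swap {J : Q.carrier → Q.carrier → Q.carrier} (hM : Q.IsMeetPair e M o l)
    (hJ : Q.IsPoly2 J) (hoo : J o o = o) (hol : J o l = l) (hlo : J l o = l) (hll : J l l = l) :
    Q.IsMeetPair e J l o where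
  ne := hM.ne.symm
  isPoly1 := hM.isPoly1
  eq_or_eq x := (hM.eq_or_eq x).symm
  map_o := hM.map_l
  map_l := hM.map_o
  isPoly2 := hJ
  meet_oo := hll
  meet_ol := hlo
  meet_lo := hol
  meet_ll := hoo
  sep a b hab := by
    obtain ⟨h, h1, h2, h3⟩ := hM.sep a b hab
    exact ⟨h, h1, fun x => (h2 x).symm, h3⟩

theorem map_eq_of_map_eq (hM : Q.IsMeetPair e M o l) (hnJ : ¬ ∃ J, Q.IsMeetPair e J l o)
    {f : Q.carrier → Q.carrier} (hf : Q.IsPoly1 f) (hU : ∀ x, f x = o ∨ f x = l)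
    (ho : f o = l) : f l = l := by
  by_contra hl
  have hl := (hU l).resolve_right hl
  refine hnJ ⟨fun a b => f (M (f a) (f b)), hM.swap
    (hf.comp (hM.isPoly2.comp (hf.comp Q.isPoly2_fst) (hf.comp Q.isPoly2_snd))) ?_ ?_ ?_ ?_⟩ <;>
  simp [ho, hl, hM.meet_oo, hM.meet_ol, hM.meet_lo, hM.meet_ll]

theorem map_eq_of_polyLE (hM : Q.IsMeetPair e M o l) (hnJ : ¬ ∃ J, Q.IsMeetPair e J l o)
    {f : Q.carrier → Q.carrier} (hf : Q.IsPoly1 f) (hU : ∀ x, f x = o ∨ f x = l)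
    {a b : Q.carrier} (hab : Q.PolyLE o l a b) (ha : f a = l) : f b = l := by
  induction hab with
  | refl => exact ha
  | tail _ hbc ih =>
    obtain ⟨k, hk, rfl, rfl⟩ := hbc
    exact hM.map_eq_of_map_eq hnJ (hf.comp hk) (fun _ => hU _) ih

/-- Without a join on `{o, l}`, a binary polynomial with values in `{o, l}` preserves meets of
elements below a common one. -/
theorem map₂_eq_of_polyLE (hM : Q.IsMeetPair e M o l) (hnJ : ¬ ∃ J, Q.IsMeetPair e J l o)
    {F : Q.carrier → Q.carrier → Q.carrier} (hF : Q.IsPoly2 F)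
    (hU : ∀ x y, F x y = o ∨ F x y = l) {a a' b b' : Q.carrier} (ha : Q.PolyLE o l a' a)
    (hb : Q.PolyLE o l b' b) (h1 : F a' b = l) (h2 : F a b' = l) : F a' b' = l := by
  have base : ∀ {G : Q.carrier → Q.carrier → Q.carrier}, Q.IsPoly2 G →
      (∀ x y, G x y = o ∨ G x y = l) → G o l = l → G l o = l → G o o = l := by
    intro G hG hGU hol hlo
    by_contra hoo
    exact hnJ ⟨G, hM.swap hG ((hGU o o).resolve_right hoo) hol hlo
      (hM.map_eq_of_map_eq hnJ (f := fun x => G x l) (hG.right l) (fun x => hGU x l) hol)⟩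
  have step : ∀ {a a' m : _}, Q.IsPoly1 m → Q.PolyLE o l a' a → F a' (m l) = l →
      F a (m o) = l → F a' (m o) = l := by
    intro a a' m hm ha
    induction ha using Relation.ReflTransGen.head_induction_on with
    | refl => exact fun _ h => h
    | head hac _ ih =>
      obtain ⟨k, hk, rfl, rfl⟩ := hac
      intro h1 h2
      refine base (G := fun x y => F (k x) (m y))
        (hF.comp (hk.comp Q.isPoly2_fst) (hm.comp Q.isPoly2_snd))
        (fun _ _ => hU _ _) h1 (ih ?_ h2)
      exact hM.map_eq_of_map_eq hnJ ((hF.right (m l)).comp hk) (fun _ => hU _ _) h1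
  induction hb using Relation.ReflTransGen.head_induction_on with
  | refl => exact h1
  | head hbd _ ih =>
    obtain ⟨m, hm, rfl, rfl⟩ := hbd
    exact step hm ha (ih (hM.map_eq_of_map_eq hnJ ((hF.left a).comp hm) (fun _ => hU _ _) h2)) h2

theorem isMeetSystem (hM : Q.IsMeetPair e M o l) (hQ : Q.IsSimple)
    (hnJ : ¬ ∃ J, Q.IsMeetPair e J l o) :
    Q.IsMeetSystem (Q.PolyLE o l) (Q.PolyUpSets o l) where
  refl _ := .refl
  trans := .trans
  le_eval := by
    classical
    intro n t r w hrw
    have key : ∀ s : Finset (Fin n), Q.PolyLE o l (t.eval Q r) (t.eval Q (s.piecewise w r)) := by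
      intro s
      induction s using Finset.induction_on with
      | empty =>
        rw [Finset.piecewise_empty]
        exact .refl
      | insert j s hj ih =>
        refine ih.trans ?_
        have := (hrw j).map (isPoly1_eval_update t (s.piecewise w r) j)
        rw [Finset.piecewise_insert]
        have hu : Function.update (s.piecewise w r) j (r j) = s.piecewise w r := by
          simp [hj]
        rwa [hu] at this
    simpa using key Finset.univ
  mono := by
    rintro _ ⟨f, hf, hU, rfl⟩ a b hab
    exact hM.map_eq_of_polyLE hnJ hf hU hab
  comp_mem := by
    rintro _ ⟨f, hf, hU, rfl⟩ n t w i
    exact ⟨_, hf.comp (isPoly1_eval_update t w i), fun _ => hU _, rfl⟩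
  inter := by
    rintro _ ⟨f, hf, hU, rfl⟩ n t w i j hij a b ha hb h1 h2
    refine hM.map₂_eq_of_polyLE hnJ
      (F := fun a b => f (t.eval Q (Function.update (Function.update w i a) j b)))
      (hf.comp (isPoly2_eval_update t w i j)) (fun _ _ => hU _) ha hb ?_ ?_
    · rwa [Function.update_comm hij, Function.update_eq_self]
    · rwa [Function.update_eq_self]
  sep := by
    intro a b h
    by_contra hab
    obtain ⟨f, hf, hU, hne⟩ := hM.sep a b hab
    have h : f a = l ↔ f b = l := h _ ⟨f, hf, hU, rfl⟩
    rcases hU a with ha | ha <;> rcases hU b with hb | hb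
    · exact hne (ha.trans hb.symm)
    · exact hne ((h.2 hb).trans hb.symm)
    · exact hne (ha.trans (h.1 ha).symm)
    · exact hne (ha.trans hb.symm)
  connected P hP a b := (hQ.iff_of_forall hM.ne (fun k hk => hP (.single ⟨k, hk, rfl, rfl⟩)) a b).1

end IsMeetPair

end UAlgebra

namespace UAlgebra

variable {σ : Signature} {Q R : UAlgebra σ} {ι : Type} [Finite ι] {A : ι → UAlgebra σ}
  {T : Set EdgeType} {p : ∀ i, R.carrier → (A i).carrier} {φ : R.carrier → Q.carrier}

/-- No subset of a subalgebra of `Q` is chosen coordinatewise by the operations. -/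
theorem not_exists_sel (hA : ∀ i, (A i).Idempotent) (h1 : ∀ i, (A i).OmitsType1)
    (hp : ∀ i, IsHom R (A i) (p i)) (inj : ∀ r s, (∀ i, p i r = p i s) → r = s)
    (hφ : IsHom R Q φ) (hs : Function.Surjective φ) {S : Set Q.carrier} (hS : Q.IsClosed S)
    {h : Q.carrier → Prop} {c q : Q.carrier} (hc : c ∈ S) (hq : q ∈ S) (hhc : h c) (hhq : ¬ h q) :
    ¬ ∀ f : σ.ops, ∃ i, ∀ r : Fin (σ.arity f) → Q.carrier, (∀ j, r j ∈ S) →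
      (h (Q.interp f r) ↔ h (r i)) := by
  intro hsel
  choose sel hsel using hsel
  obtain ⟨u, rfl⟩ := hs c
  obtain ⟨v, rfl⟩ := hs q
  have hW := hφ.isClosed_preimage hS
  refine not_isHom_projAlg (R := R.subalg (φ ⁻¹' S) hW) (sel := sel) (φ := fun r => h (φ r.1))
    (u := ⟨u, hc⟩) (v := ⟨v, hq⟩) hA h1 (fun i => (hp i).comp (isHom_val _ hW))
    (fun r s hrs => Subtype.ext (inj _ _ hrs)) (fun f x => propext ?_) ?_
  · change h (φ (R.interp f fun j => (x j).1)) ↔ _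
    rw [hφ f]
    exact hsel f _ fun j => (x j).2
  · exact fun he => hhq (he ▸ hhc)

theorem not_isSetAlgebra (hA : ∀ i, (A i).Idempotent) (h1 : ∀ i, (A i).OmitsType1)
    (hp : ∀ i, IsHom R (A i) (p i)) (inj : ∀ r s, (∀ i, p i r = p i s) → r = s)
    (hφ : IsHom R Q φ) (hs : Function.Surjective φ) {x y : Q.carrier} (hxy : x ≠ y) :
    ¬ Q.IsSetAlgebra := by
  intro hset
  refine not_exists_sel hA h1 hp inj hφ hs Q.isClosed_univ (h := fun z => z = x) (c := x) (q := y)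
    trivial trivial rfl hxy.symm fun f => ?_
  obtain ⟨i, hi⟩ := hset _ (.app f fun j => .var j)
  refine ⟨i, fun r _ => ?_⟩
  have : Q.interp f r = r i := hi r
  rw [this]

theorem affine_mem [∀ i, Finite (A i).carrier] (hA : ∀ i, (A i).Idempotent)
    (hres : ∀ i, (A i).Restricted T) (hT : EdgeType.unary ∉ T)
    (hp : ∀ i, IsHom R (A i) (p i)) (inj : ∀ r s, (∀ i, p i r = p i s) → r = s)
    (hφ : IsHom R Q φ) (hs : Function.Surjective φ) (hi : Q.Idempotent) (hQ : Q.IsSimple)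
    {x y : Q.carrier} (hxy : x ≠ y) (h : Q.IsAffineAlgebra) : EdgeType.affine ∈ T := by
  obtain ⟨u, rfl⟩ := hs x
  obtain ⟨v, rfl⟩ := hs y
  have hQs := h.isStrictlySimple hQ
  obtain ⟨i, S, hS, ψ, hψ, sψ⟩ := exists_isHom_subalg_factor hA hp inj hφ hQs hxy
  obtain ⟨τ, hτ, x, y, hne, ht⟩ := (hres i).exists_isOfType (hA i) hψ sψ hQs ⟨_, _, hxy⟩
    fun _ _ _ => Or.inr (Or.inl h)
  cases τ with
  | unary => exact absurd hτ hT
  | semilattice => exact absurd ht (h.not_hasSemilattice hi hne)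
  | majority => exact absurd ht.1 (h.not_hasMajority hne)
  | affine => exact hτ

theorem majority_mem [∀ i, Finite (A i).carrier] (hA : ∀ i, (A i).Idempotent)
    (hsm : ∀ i, (A i).IsSmooth) (h1 : ∀ i, (A i).OmitsType1)
    (hres : ∀ i, (A i).Restricted T) (hT : EdgeType.unary ∉ T) [Finite R.carrier]
    (hp : ∀ i, IsHom R (A i) (p i)) (inj : ∀ r s, (∀ i, p i r = p i s) → r = s)
    (hφ : IsHom R Q φ) (hs : Function.Surjective φ) (hi : Q.Idempotent) (hQ : Q.IsSimple)
    {u v : R.carrier} (hR : R.ClosureSet {u, v} = Set.univ) (huv : φ u ≠ φ v)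
    (hm : Q.HasMajority (φ u) (φ v)) (hsl : ¬ Q.HasSemilattice (φ u) (φ v)) :
    EdgeType.majority ∈ T := by
  have : Finite Q.carrier := Finite.of_surjective φ hs
  obtain ⟨e, M, o, l, hM⟩ := hm.exists_isMeetPair hQ hi huv
  by_cases hJ : ∃ J, Q.IsMeetPair e J l o
  · obtain ⟨J, hJ⟩ := hJ
    obtain ⟨i, hfac⟩ := hM.exists_factor hJ hφ hs hp inj
    exact (hres i).majority_mem (hA i) (hsm i) hT hR (hp i) hφ hs hQ hfac huv hm hsl
  · refine absurd ((hM.isMeetSystem hQ hJ).hasSemilattice hi ?_ ?_) hsl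
    · rintro c q h ⟨-, -, hc, hq⟩
      exact not_exists_sel hA h1 hp inj hφ hs (Q.closureSet_isClosed _)
        (Q.subset_closureSet _ (Or.inl rfl)) (Q.subset_closureSet _ (Or.inr rfl)) hc hq
    · refine Set.eq_univ_of_forall fun z => ?_
      obtain ⟨r, rfl⟩ := hs z
      have hr : r ∈ R.ClosureSet {u, v} := hR ▸ trivial
      refine closureSet_subset (hφ.isClosed_preimage (Q.closureSet_isClosed _)) ?_ hr
      rintro w (rfl | rfl)
      · exact Q.subset_closureSet _ (Or.inl rfl)
      · exact Q.subset_closureSet _ (Or.inr rfl)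

end UAlgebra

/-- a finite direct product of similar smooth finite idempotent
`T`-restricted algebras omitting type 1 is `T`-restricted. -/
theorem stmt_1 (σ : Signature) (T : Set EdgeType)
    (hT : T ⊆ {EdgeType.semilattice, EdgeType.majority, EdgeType.affine})
    (n : ℕ) (A : Fin n → UAlgebra σ)
    (hfin : ∀ i, Finite (A i).carrier) (hne : ∀ i, Nonempty (A i).carrier)
    (hid : ∀ i, (A i).Idempotent) (hsm : ∀ i, (A i).IsSmooth)
    (h1 : ∀ i, (A i).OmitsType1) (hres : ∀ i, (A i).Restricted T) :
    (UAlgebra.pi A).Restricted T := by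
  intro a b hab
  have hu : EdgeType.unary ∉ T := fun h => by simpa using hT h
  have : Finite (UAlgebra.pi A).carrier := Pi.finite
  have hP := UAlgebra.Idempotent.pi hid
  have hR : ((UAlgebra.pi A).Sg {a, b}).Idempotent := hP.subalg _ _
  have : Finite ((UAlgebra.pi A).Sg {a, b}).carrier := Subtype.finite
  obtain ⟨η, hη, hxy, h⟩ := hab.exists_isMaximal hP
  have hφ := η.isHom_mk
  have hs : Function.Surjective (Quotient.mk η.toSetoid) := Quotient.mk_surjective
  have hi := hR.of_surjective hφ hs
  have hQ := hη.isSimple_quot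
  have hp : ∀ i, UAlgebra.IsHom ((UAlgebra.pi A).Sg {a, b}) (A i) fun r => r.1 i :=
    fun _ _ _ => rfl
  have inj : ∀ r s : ((UAlgebra.pi A).Sg {a, b}).carrier, (∀ i, r.1 i = s.1 i) → r = s :=
    fun _ _ h => Subtype.ext (funext h)
  suffices ∃ τ ∈ T, (((UAlgebra.pi A).Sg {a, b}).quot η).IsOfType τ
      ((UAlgebra.pi A).qa a b η) ((UAlgebra.pi A).qb a b η) by
    obtain ⟨τ, hτ, ht⟩ := this
    exact ⟨τ, hτ, (UAlgebra.hasEdgeOfType_iff τ a b).2 ⟨hab.1, η, hη, ht⟩⟩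
  by_cases hsl : (((UAlgebra.pi A).Sg {a, b}).quot η).HasSemilattice
      ((UAlgebra.pi A).qa a b η) ((UAlgebra.pi A).qb a b η)
  · exact ⟨_, UAlgebra.semilattice_mem hid hres hu hR hp inj hφ hs hxy hsl, hsl⟩
  rcases h with h | h | h | h
  · exact absurd h (UAlgebra.not_isSetAlgebra hid h1 hp inj hφ hs hxy)
  · exact ⟨_, UAlgebra.affine_mem hid hres hu hp inj hφ hs hi hQ hxy h, h⟩
  · exact absurd h hsl
  · exact ⟨_, UAlgebra.majority_mem hid hsm h1 hres hu hp inj hφ hs hi hQ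
      ((UAlgebra.pi A).closureSet_sg a b) hxy h hsl, h, hsl⟩
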